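/- Let S be a maximal star decomposition of a cyclic polygon P. Then for every pair of distinct stars S₁(V₁,E₁) and S₂(V₂,E₂) of S, there is exactly one linkable pair (v₁, v₂) with v₁ ∈ V₁ and v₂ ∈ V₂. -/

import Mathlib

open Complex
open scoped Classical

noncomputable section

/-- The anticlockwise arc displacement from `u` to `v` on the unit circle, lying in `(0, 2π]`
(equal to `2π` when `v = u`). -/
def posArc (u v : ℂ) : ℝ :=
  if 0 < Complex.arg (v / u) then Complex.arg (v / u) else Complex.arg (v / u) + 2 * Real.pi

/-- `u, v, w` occur in anticlockwise order on the circle. -/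
def ACW (u v w : ℂ) : Prop :=
  u ≠ v ∧ v ≠ w ∧ u ≠ w ∧ posArc u v < posArc u w

/-- The open anticlockwise arc from `u` to `v`. -/
def arcOO (u v : ℂ) : Set ℂ := {x | x ≠ u ∧ x ≠ v ∧ posArc u x < posArc u v}

/-- The anticlockwise arc from `u` to `v`, open at `u` and closed at `v`. -/
def arcOC (u v : ℂ) : Set ℂ := {x | x ≠ u ∧ (x = v ∨ posArc u x < posArc u v)}

/-- The closed anticlockwise arc from `u` to `v`. -/
def arcCC (u v : ℂ) : Set ℂ := {x | x = u ∨ x = v ∨ (x ≠ u ∧ posArc u x < posArc u v)}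

/-- The (undirected) angle `∠ x v z` at apex `v`. -/
def vangle (x v z : ℂ) : ℝ := |Complex.arg ((x - v) / (z - v))|

/-- A cyclic polygon: a finite set of vertices on the unit circle together with a set of
directed edges such that every vertex has indegree and outdegree one, and any two
consecutive edges `uv`, `vw` have `u, v, w` in anticlockwise order. -/
structure CyclicPolygon where
  V : Finset ℂ
  E : Finset (ℂ × ℂ)
  nonempty : V.Nonempty
  onCircle : ∀ v ∈ V, ‖v‖ = 1
  endmem : ∀ e ∈ E, e.1 ∈ V ∧ e.2 ∈ V
  outdeg : ∀ v ∈ V, ∃! w, (v, w) ∈ E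
  indeg : ∀ v ∈ V, ∃! u, (u, v) ∈ E
  acw : ∀ u v w : ℂ, (u, v) ∈ E → (v, w) ∈ E → ACW u v w

namespace CyclicPolygon

/-- The successor `v⁺` of a vertex. -/
noncomputable def next (P : CyclicPolygon) (v : ℂ) : ℂ :=
  if h : ∃ w, (v, w) ∈ P.E then h.choose else v

/-- The predecessor `v⁻` of a vertex. -/
noncomputable def prev (P : CyclicPolygon) (v : ℂ) : ℂ :=
  if h : ∃ u, (u, v) ∈ P.E then h.choose else v

end CyclicPolygon

/-- The interior angle `∠ v⁻ v v⁺` of `P` at `v`. -/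
def interiorAngle (P : CyclicPolygon) (v : ℂ) : ℝ :=
  vangle (P.prev v) v (P.next v)

/-- The length of an edge `uv`: the number of vertices on the open anticlockwise
arc from `u` to `v`, plus one. -/
def edgeLength (P : CyclicPolygon) (u v : ℂ) : ℕ :=
  ((P.V : Set ℂ) ∩ arcOO u v).ncard + 1

/-- A `k`-star: a cyclic polygon with `2k+1` vertices all of whose edges have length `k`. -/
def IsKStar (S : CyclicPolygon) (k : ℕ) : Prop :=
  S.V.card = 2 * k + 1 ∧ ∀ e ∈ S.E, edgeLength S e.1 e.2 = k

/-- A star: a `k`-star for some positive integer `k`. -/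
def IsStar (S : CyclicPolygon) : Prop := ∃ k : ℕ, 0 < k ∧ IsKStar S k

/-- The segment from `u` to `x` splits the interior angle `∠ u⁻ u u⁺` of `S` at `u`
into the two (smaller, nonzero) angles `∠ u⁻ u x` and `∠ x u u⁺`. -/
def SplitsVertexAngle (S : CyclicPolygon) (u x : ℂ) : Prop :=
  u ∈ S.V ∧ 0 < vangle (S.prev u) u x ∧ 0 < vangle x u (S.next u) ∧
    vangle (S.prev u) u x + vangle x u (S.next u) = vangle (S.prev u) u (S.next u)

/-- `(u, v)` is a linkable pair for the pair of cyclic polygons `(S₁, S₂)`: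
the segment `uv` splits the angle of `S₁` at `u` and the angle of `S₂` at `v`. -/
def LinkablePair (S₁ S₂ : CyclicPolygon) (u v : ℂ) : Prop :=
  u ≠ v ∧ SplitsVertexAngle S₁ u v ∧ SplitsVertexAngle S₂ v u

/-- `u, v` is a linkable pair of vertices of the cyclic polygon `P`. -/
def Linkable (P : CyclicPolygon) (u v : ℂ) : Prop := LinkablePair P P u v

/-- `D` is a set of (undirected) diagonals of `P`, i.e. every member joins a linkable pair. -/
def IsDiagonalSet (P : CyclicPolygon) (D : Set (Sym2 ℂ)) : Prop :=
  ∀ u v : ℂ, s(u, v) ∈ D → Linkable P u v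

/-- The set `D̃` of directed edges associated to a set of diagonals `D`. -/
def tilde (D : Set (Sym2 ℂ)) : Set (ℂ × ℂ) := {e | s(e.1, e.2) ∈ D}

/-- The segment from `v` towards `x` splits the angle `∠ u v w`. -/
def SplitsAngle3 (u v w x : ℂ) : Prop :=
  0 < vangle u v x ∧ 0 < vangle x v w ∧ vangle u v x + vangle x v w = vangle u v w

/-- `𝒮` is a star decomposition of `P` with respect to the diagonal set `D`: the
cycle decomposition of `E ∪ D̃` determined by `f_next` (each cycle follows the
tightest turn, i.e. no diagonal of `D` splits the angle between two consecutive
edges of a cycle), all of whose cycles are stars. -/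
def IsStarDecomp (P : CyclicPolygon) (D : Set (Sym2 ℂ)) (𝒮 : Finset CyclicPolygon) : Prop :=
  IsDiagonalSet P D ∧
  (∀ S ∈ 𝒮, IsStar S ∧ (S.V : Set ℂ) ⊆ (P.V : Set ℂ)) ∧
  (∀ S ∈ 𝒮, (S.E : Set (ℂ × ℂ)) ⊆ (P.E : Set (ℂ × ℂ)) ∪ tilde D) ∧
  (∀ e ∈ (P.E : Set (ℂ × ℂ)) ∪ tilde D, ∃ S ∈ 𝒮, e ∈ S.E) ∧
  (∀ S₁ ∈ 𝒮, ∀ S₂ ∈ 𝒮, S₁ ≠ S₂ → ∀ e : ℂ × ℂ, e ∈ S₁.E → e ∉ S₂.E) ∧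
  (∀ S ∈ 𝒮, ∀ u v w : ℂ, (u, v) ∈ S.E → (v, w) ∈ S.E →
      ¬ ∃ x, s(v, x) ∈ D ∧ SplitsAngle3 u v w x)

/-- `P` admits a star decomposition with respect to `D`. -/
def HasStarDecomp (P : CyclicPolygon) (D : Set (Sym2 ℂ)) : Prop :=
  ∃ 𝒮 : Finset CyclicPolygon, IsStarDecomp P D 𝒮

/-- A maximal star decomposition: no proper superset of `D` admits a star decomposition. -/
def IsMaximalStarDecomp (P : CyclicPolygon) (D : Set (Sym2 ℂ))
    (𝒮 : Finset CyclicPolygon) : Prop :=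
  IsStarDecomp P D 𝒮 ∧ ∀ D' : Set (Sym2 ℂ), D ⊂ D' → ¬ HasStarDecomp P D'

/-- `D'` is obtained from `D` by a diagonal flip: remove one diagonal and add another. -/
def FlipStep (D D' : Set (Sym2 ℂ)) : Prop :=
  ∃ e f : Sym2 ℂ, e ∈ D ∧ f ∉ D ∧ D' = (D \ {e}) ∪ {f}

/-- The two chords `ab` and `cd` are crossing: they share no endpoint and
intersect inside the circle. -/
def Crossing (a b c d : ℂ) : Prop :=
  a ≠ c ∧ a ≠ d ∧ b ≠ c ∧ b ≠ d ∧ (openSegment ℝ a b ∩ openSegment ℝ c d).Nonempty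

/-- The two chords `ab` and `cd` share a common point: they have a common
endvertex or intersect inside the circle. -/
def ShareCommonPoint (a b c d : ℂ) : Prop :=
  a = c ∨ a = d ∨ b = c ∨ b = d ∨ (openSegment ℝ a b ∩ openSegment ℝ c d).Nonempty

/-- Two cyclic polygons have a pair of overlapped angles: a common vertex `y` and a vertex
`x` of either polygon lying on both arcs `⦅y⁺ y⁻⟧` (taken in each polygon). -/
def OverlappedAngles (S₁ S₂ : CyclicPolygon) : Prop :=
  ∃ y : ℂ, y ∈ S₁.V ∧ y ∈ S₂.V ∧
    ∃ x : ℂ, (x ∈ S₁.V ∨ x ∈ S₂.V) ∧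
      x ∈ arcOC (S₁.next y) (S₁.prev y) ∧ x ∈ arcOC (S₂.next y) (S₂.prev y)

/-- Two cyclic polygons are mutually independent: no two of their angles are overlapped. -/
def IndepPolygons (S₁ S₂ : CyclicPolygon) : Prop := ¬ OverlappedAngles S₁ S₂

/-- The edge `uv` of `P` is minimal: no edge `xy` of `P` has all vertices of the closed
arc from `x` to `y` inside the open arc from `u` to `v`. -/
def MinimalEdge (P : CyclicPolygon) (u v : ℂ) : Prop :=
  (u, v) ∈ P.E ∧
    ¬ ∃ x y : ℂ, (x, y) ∈ P.E ∧ ∀ z ∈ P.V, z ∈ arcCC x y → z ∈ arcOO u v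

/-- `vs` enumerates the star `S` as `v₀ v₁ ⋯ v₂ₖ` with `v₁ = v`, `v₀ = v⁻` (so that `v⁻v`
is an edge of `S`), each edge of `S` is an edge of `P` or a diagonal of `P`, and all the
edges `v₂ᵢ₋₁v₂ᵢ` are edges of `P`. -/
def IsBorderCandidate (P : CyclicPolygon) (v : ℂ) (S : CyclicPolygon) (k : ℕ)
    (vs : ℕ → ℂ) : Prop :=
  0 < k ∧ IsStar S ∧ S.V.card = 2 * k + 1 ∧
  (S.V : Set ℂ) ⊆ (P.V : Set ℂ) ∧
  vs 0 = P.prev v ∧ vs 1 = v ∧ vs (2 * k + 1) = vs 0 ∧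
  (∀ x ∈ S.V, ∃ i ≤ 2 * k, vs i = x) ∧
  (∀ i ≤ 2 * k, (vs i, vs (i + 1)) ∈ S.E) ∧
  (∀ i ≤ 2 * k, (vs i, vs (i + 1)) ∈ P.E ∨ Linkable P (vs i) (vs (i + 1))) ∧
  (∀ i : ℕ, 1 ≤ i → i ≤ k → (vs (2 * i - 1), vs (2 * i)) ∈ P.E)

/-- The angle sequence `(∠v₁v₂v₃, ∠v₃v₄v₅, …, ∠v₂ₖ₋₁v₂ₖv₀)` of an enumerated star. -/
noncomputable def angleList (vs : ℕ → ℂ) (k : ℕ) : List ℝ :=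
  (List.range k).map fun i => vangle (vs (2 * i + 1)) (vs (2 * i + 2)) (vs (2 * i + 3))

/-- `S` is the border star `S*(P, v)`: among all border candidates, its angle sequence is
lexicographically minimal. -/
def IsBorderStar (P : CyclicPolygon) (v : ℂ) (S : CyclicPolygon) : Prop :=
  ∃ (k : ℕ) (vs : ℕ → ℂ), IsBorderCandidate P v S k vs ∧
    ∀ (S' : CyclicPolygon) (k' : ℕ) (vs' : ℕ → ℂ), IsBorderCandidate P v S' k' vs' →
      ¬ List.Lex (· < ·) (angleList vs' k') (angleList vs k)


namespace ULP

/-- strict cyclic order of the arguments -/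
def Cy (a b c : ℂ) : Prop :=
  (arg a < arg b ∧ arg b < arg c) ∨ (arg b < arg c ∧ arg c < arg a) ∨
    (arg c < arg a ∧ arg a < arg b)

lemma arg_inj {x y : ℂ} (hx : ‖x‖ = 1) (hy : ‖y‖ = 1) (h : arg x = arg y) : x = y :=
  Complex.ext_norm_arg (hx.trans hy.symm) h

lemma eq_exp {x : ℂ} (hx : ‖x‖ = 1) : x = exp (arg x * I) := by
  have := Complex.norm_mul_exp_arg_mul_I x
  rw [hx] at this
  simpa using this.symm

lemma div_eq_exp {u v : ℂ} (hu : ‖u‖ = 1) (hv : ‖v‖ = 1) :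
    v / u = exp (((arg v - arg u : ℝ) : ℂ) * I) := by
  conv_lhs => rw [eq_exp hu, eq_exp hv]
  rw [← Complex.exp_sub]
  congr 1
  push_cast
  ring

lemma arg_exp_of {θ φ : ℝ} (n : ℤ) (h : θ = φ + n * (2 * Real.pi)) (h1 : -Real.pi < φ)
    (h2 : φ ≤ Real.pi) : arg (exp ((θ : ℂ) * I)) = φ := by
  have : exp ((θ : ℂ) * I) = exp ((φ : ℂ) * I) := by
    rw [Complex.exp_eq_exp_iff_exists_int]
    refine ⟨n, ?_⟩
    rw [h]; push_cast; ring
  rw [this, Complex.exp_mul_I]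
  exact Complex.arg_cos_add_sin_mul_I ⟨h1, h2⟩

lemma posArc_eq {u v : ℂ} (hu : ‖u‖ = 1) (hv : ‖v‖ = 1) :
    posArc u v = if arg u < arg v then arg v - arg u else arg v - arg u + 2 * Real.pi := by
  have a1 := Complex.neg_pi_lt_arg u
  have a2 := Complex.arg_le_pi u
  have b1 := Complex.neg_pi_lt_arg v
  have b2 := Complex.arg_le_pi v
  unfold posArc
  rw [div_eq_exp hu hv]
  have hp := Real.pi_pos
  by_cases c1 : Real.pi < arg v - arg u
  · rw [arg_exp_of (φ := arg v - arg u - 2 * Real.pi) 1 (by push_cast; ring) (by linarith)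
      (by linarith)]
    split_ifs <;> linarith
  · by_cases c2 : arg v - arg u ≤ - Real.pi
    · rw [arg_exp_of (φ := arg v - arg u + 2 * Real.pi) (-1) (by push_cast; ring) (by linarith)
        (by linarith)]
      split_ifs <;> linarith
    · rw [arg_exp_of (φ := arg v - arg u) 0 (by push_cast; ring) (by linarith)
        (by linarith)]
      split_ifs <;> linarith

lemma posArc_lt_iff {u v w : ℂ} (hu : ‖u‖ = 1) (hv : ‖v‖ = 1) (hw : ‖w‖ = 1)
    (huv : v ≠ u) (huw : w ≠ u) :
    posArc u v < posArc u w ↔ Cy u v w := by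
  have a1 := Complex.neg_pi_lt_arg u
  have a2 := Complex.arg_le_pi u
  have b1 := Complex.neg_pi_lt_arg v
  have b2 := Complex.arg_le_pi v
  have c1 := Complex.neg_pi_lt_arg w
  have c2 := Complex.arg_le_pi w
  have h1 : arg v ≠ arg u := fun h => huv (arg_inj hv hu h)
  have h2 : arg w ≠ arg u := fun h => huw (arg_inj hw hu h)
  rw [posArc_eq hu hv, posArc_eq hu hw]
  unfold Cy
  have hp := Real.pi_pos
  constructor
  · intro h
    split_ifs at h with c1 c2 c2 <;> grind
  · intro h
    split_ifs with c1 c2 c2 <;> grind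

lemma acw_iff {u v w : ℂ} (hu : ‖u‖ = 1) (hv : ‖v‖ = 1) (hw : ‖w‖ = 1) :
    ACW u v w ↔ Cy u v w := by
  constructor
  · rintro ⟨h1, h2, h3, h4⟩
    exact (posArc_lt_iff hu hv hw h1.symm h3.symm).1 h4
  · intro h
    have h1 : u ≠ v := by rintro rfl; unfold Cy at h; grind
    have h2 : v ≠ w := by rintro rfl; unfold Cy at h; grind
    have h3 : u ≠ w := by rintro rfl; unfold Cy at h; grind
    exact ⟨h1, h2, h3, (posArc_lt_iff hu hv hw h1.symm h3.symm).2 h⟩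

lemma mem_arcOO_iff {u v x : ℂ} (hu : ‖u‖ = 1) (hv : ‖v‖ = 1) (hx : ‖x‖ = 1) (huv : u ≠ v) :
    x ∈ arcOO u v ↔ Cy u x v := by
  rw [← acw_iff hu hx hv]
  unfold arcOO ACW
  simp only [Set.mem_ofPred_eq]
  tauto

lemma posArc_pos {u v : ℂ} (hu : ‖u‖ = 1) (hv : ‖v‖ = 1) : 0 < posArc u v := by
  have a2 := Complex.arg_le_pi u
  have b1 := Complex.neg_pi_lt_arg v
  rw [posArc_eq hu hv]; split_ifs <;> linarith

lemma posArc_lt {u v : ℂ} (hu : ‖u‖ = 1) (hv : ‖v‖ = 1) (h : v ≠ u) :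
    posArc u v < 2 * Real.pi := by
  have a2 := Complex.neg_pi_lt_arg u
  have b1 := Complex.arg_le_pi v
  have h1 : arg v ≠ arg u := fun e => h (arg_inj hv hu e)
  rw [posArc_eq hu hv]; split_ifs with h2
  · linarith
  · have := lt_of_le_of_ne (not_lt.1 h2) h1
    linarith

lemma posArc_exp {u v : ℂ} (hu : ‖u‖ = 1) (hv : ‖v‖ = 1) :
    v = u * exp ((posArc u v : ℂ) * I) := by
  have hu0 : u ≠ 0 := by intro h; simp [h] at hu
  have : exp ((posArc u v : ℂ) * I) = v / u := by
    rw [div_eq_exp hu hv, posArc_eq hu hv]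
    split_ifs
    · rfl
    · rw [Complex.exp_eq_exp_iff_exists_int]
      exact ⟨1, by push_cast; ring⟩
  rw [this]; field_simp

lemma exp_sub_one (s : ℝ) :
    exp ((s : ℂ) * I) - 1 = exp (((s / 2 : ℝ) : ℂ) * I) * (2 * I * (Real.sin (s / 2) : ℂ)) := by
  have h1 : exp ((s : ℂ) * I) = exp (((s / 2 : ℝ) : ℂ) * I) * exp (((s / 2 : ℝ) : ℂ) * I) := by
    rw [← Complex.exp_add]; congr 1; push_cast; ring
  have h2 : (2 * I * (Real.sin (s / 2) : ℂ)) =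
      exp (((s / 2 : ℝ) : ℂ) * I) - exp (-(((s / 2 : ℝ) : ℂ) * I)) := by
    rw [Complex.ofReal_sin, Complex.sin, neg_mul]
    linear_combination (exp (-(((s / 2 : ℝ) : ℂ) * I)) - exp (((s / 2 : ℝ) : ℂ) * I)) * I_mul_I
  rw [h1, h2, mul_sub, ← Complex.exp_add (((s / 2 : ℝ) : ℂ) * I) (-_)]
  simp

lemma vangle_eq {x v z : ℂ} (hx : ‖x‖ = 1) (hv : ‖v‖ = 1) (hz : ‖z‖ = 1)
    (hxv : x ≠ v) (hzv : z ≠ v) : vangle x v z = |posArc v x - posArc v z| / 2 := by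
  have hv0 : v ≠ 0 := by intro h; simp [h] at hv
  have p1 := posArc_pos hv hx
  have p2 := posArc_lt hv hx hxv
  have q1 := posArc_pos hv hz
  have q2 := posArc_lt hv hz hzv
  have s1 : 0 < Real.sin (posArc v x / 2) := Real.sin_pos_of_pos_of_lt_pi (by linarith) (by linarith)
  have s2 : 0 < Real.sin (posArc v z / 2) := Real.sin_pos_of_pos_of_lt_pi (by linarith) (by linarith)
  have key : (x - v) / (z - v) =
      ((Real.sin (posArc v x / 2) / Real.sin (posArc v z / 2) : ℝ) : ℂ) *
        exp ((((posArc v x - posArc v z) / 2 : ℝ) : ℂ) * I) := by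
    have e1 : x - v = v * (exp ((posArc v x : ℂ) * I) - 1) := by
      rw [mul_sub, ← posArc_exp hv hx]; ring
    have e2 : z - v = v * (exp ((posArc v z : ℂ) * I) - 1) := by
      rw [mul_sub, ← posArc_exp hv hz]; ring
    have e3 : exp ((((posArc v x - posArc v z) / 2 : ℝ) : ℂ) * I) =
        exp (((posArc v x / 2 : ℝ) : ℂ) * I) / exp (((posArc v z / 2 : ℝ) : ℂ) * I) := by
      rw [← Complex.exp_sub]; congr 1; push_cast; ring
    have s2' : (Real.sin (posArc v z / 2) : ℂ) ≠ 0 := by exact_mod_cast s2.ne'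
    have hI := Complex.I_ne_zero
    have he := Complex.exp_ne_zero (((posArc v z / 2 : ℝ) : ℂ) * I)
    have e4 : ((Real.sin (posArc v x / 2) / Real.sin (posArc v z / 2) : ℝ) : ℂ) =
      (Real.sin (posArc v x / 2) : ℂ) / (Real.sin (posArc v z / 2) : ℂ) := Complex.ofReal_div _ _
    rw [e1, e2, e3, exp_sub_one, exp_sub_one, e4]
    clear e4
    generalize exp (((posArc v z / 2 : ℝ) : ℂ) * I) = A at *
    generalize exp (((posArc v x / 2 : ℝ) : ℂ) * I) = B at *
    generalize (Real.sin (posArc v z / 2) : ℂ) = C at *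
    field_simp
  unfold vangle
  rw [key, Complex.arg_real_mul _ (div_pos s1 s2),
    arg_exp_of (φ := (posArc v x - posArc v z) / 2) 0 (by push_cast; ring) (by linarith)
      (by linarith), abs_div]
  norm_num

lemma splits_iff {u v w x : ℂ} (hu : ‖u‖ = 1) (hv : ‖v‖ = 1) (hw : ‖w‖ = 1) (hx : ‖x‖ = 1)
    (huvw : Cy u v w) (hxv : x ≠ v) :
    SplitsAngle3 u v w x ↔ Cy v w x ∧ Cy v x u := by
  have huv : u ≠ v := by rintro rfl; unfold Cy at huvw; grind
  have hwv : w ≠ v := by rintro rfl; unfold Cy at huvw; grind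
  have h0 : posArc v w < posArc v u :=
    (posArc_lt_iff hv hw hu hwv huv).2 (by unfold Cy at *; grind)
  unfold SplitsAngle3
  rw [vangle_eq hu hv hx huv hxv, vangle_eq hx hv hw hxv hwv, vangle_eq hu hv hw huv hwv,
    ← posArc_lt_iff hv hw hx hwv hxv, ← posArc_lt_iff hv hx hu hxv huv]
  constructor
  · rintro ⟨h1, h2, h3⟩
    have h1' : posArc v u - posArc v x ≠ 0 := by intro h; rw [h] at h1; simp at h1
    have h2' : posArc v x - posArc v w ≠ 0 := by intro h; rw [h] at h2; simp at h2
    rw [abs_of_pos (sub_pos.2 h0)] at h3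
    rcases lt_or_gt_of_ne h1' with c1 | c1 <;> rcases lt_or_gt_of_ne h2' with c2 | c2
    · exact ⟨by linarith, by linarith⟩
    · rw [abs_of_neg c1, abs_of_pos c2] at h3; exact ⟨by linarith, by linarith⟩
    · rw [abs_of_pos c1, abs_of_neg c2] at h3; exact ⟨by linarith, by linarith⟩
    · exact ⟨by linarith, by linarith⟩
  · rintro ⟨h1, h2⟩
    rw [abs_of_pos (sub_pos.2 h0), abs_of_pos (sub_pos.2 h1), abs_of_pos (sub_pos.2 h2)]
    refine ⟨by linarith, by linarith, by ring⟩

/-- number of points of `V` on the open arc from `p` to `q` -/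
def cnt (V : Finset ℂ) (p q : ℂ) : ℕ := (V.filter (fun x => Cy p x q)).card

/-- all points lie on the unit circle -/
def OnC (V : Finset ℂ) : Prop := ∀ x ∈ V, ‖x‖ = 1

lemma Cy.rot {a b c : ℂ} (h : Cy a b c) : Cy b c a := by unfold Cy at *; grind

lemma Cy.ne {a b c : ℂ} (h : Cy a b c) : a ≠ b ∧ b ≠ c ∧ a ≠ c := by
  unfold Cy at *
  refine ⟨?_, ?_, ?_⟩ <;> rintro rfl <;> grind

lemma Cy.not_swap {a b c : ℂ} (h : Cy a b c) : ¬ Cy a c b := by unfold Cy at *; grind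

lemma arg_ne {x y : ℂ} (hx : ‖x‖ = 1) (hy : ‖y‖ = 1) (h : x ≠ y) : arg x ≠ arg y :=
  fun e => h (arg_inj hx hy e)

lemma Cy.total {a b c : ℂ} (ha : ‖a‖ = 1) (hb : ‖b‖ = 1) (hc : ‖c‖ = 1)
    (hab : a ≠ b) (hbc : b ≠ c) (hac : a ≠ c) : Cy a b c ∨ Cy a c b := by
  have := arg_ne ha hb hab
  have := arg_ne hb hc hbc
  have := arg_ne ha hc hac
  unfold Cy; grind

lemma Cy.trans {a b c d : ℂ} (h : Cy a b c) (h' : Cy a c d) : Cy a b d := by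
  unfold Cy at *; grind

lemma cnt_split {V : Finset ℂ} (hV : OnC V) {p q r : ℂ} (hr : ‖r‖ = 1) (h : Cy p r q) :
    cnt V p q = cnt V p r + (if r ∈ V then 1 else 0) + cnt V r q := by
  unfold cnt
  rw [Finset.card_filter, Finset.card_filter, Finset.card_filter,
    ← Finset.sum_ite_eq V r (fun _ => 1), ← Finset.sum_add_distrib, ← Finset.sum_add_distrib]
  refine Finset.sum_congr rfl fun x hx => ?_
  by_cases e : r = x
  · subst e
    have h1 : ¬ Cy p r r := fun h => h.ne.2.1 rfl
    have h2 : ¬ Cy r r q := fun h => h.ne.1 rfl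
    simp [h, h1, h2]
  · have := arg_ne hr (hV x hx) e
    unfold Cy at *
    simp only [e, if_false]
    grind

lemma cnt_total {V : Finset ℂ} (hV : OnC V) {p q : ℂ} (hp : ‖p‖ = 1) (hq : ‖q‖ = 1) (h : p ≠ q) :
    V.card = cnt V p q + cnt V q p + (if p ∈ V then 1 else 0) + (if q ∈ V then 1 else 0) := by
  unfold cnt
  rw [Finset.card_eq_sum_ones, Finset.card_filter, Finset.card_filter,
    ← Finset.sum_ite_eq V p (fun _ => 1), ← Finset.sum_ite_eq V q (fun _ => 1),
    ← Finset.sum_add_distrib, ← Finset.sum_add_distrib, ← Finset.sum_add_distrib]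
  refine Finset.sum_congr rfl fun x hx => ?_
  have hpq := arg_ne hp hq h
  by_cases e : p = x
  · subst e
    have h1 : ¬ Cy p p q := fun h => h.ne.1 rfl
    have h2 : ¬ Cy q p p := fun h => h.ne.2.1 rfl
    simp [h.symm, h1, h2]
  · by_cases e' : q = x
    · subst e'
      have h1 : ¬ Cy p q q := fun h => h.ne.2.1 rfl
      have h2 : ¬ Cy q q p := fun h => h.ne.1 rfl
      simp [e, h1, h2]
    · have := arg_ne hp (hV x hx) e
      have := arg_ne hq (hV x hx) e'
      unfold Cy at *
      simp only [e, e', if_false]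
      grind

lemma cnt_lt {V : Finset ℂ} (hV : OnC V) {p q r : ℂ} (hr : r ∈ V) (h : Cy p r q) :
    cnt V p r < cnt V p q := by
  have := cnt_split hV (hV r hr) h
  simp [hr] at this; omega

lemma cnt_le {V : Finset ℂ} (hV : OnC V) {p q r : ℂ} (hr : ‖r‖ = 1) (h : Cy p r q) :
    cnt V p r ≤ cnt V p q := by
  have := cnt_split hV hr h
  omega

/-- combinatorial edges of the star with vertex set `V` -/
def SE (V : Finset ℂ) (k : ℕ) (p q : ℂ) : Prop := p ∈ V ∧ q ∈ V ∧ p ≠ q ∧ cnt V p q + 1 = k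

lemma exists_cnt {V : Finset ℂ} (hV : OnC V) {k : ℕ} (hc : V.card = 2 * k + 1)
    {v : ℂ} (hv : v ∈ V) {m : ℕ} (hm : m < 2 * k) :
    ∃! w, w ∈ V ∧ v ≠ w ∧ cnt V v w = m := by
  have inj : ∀ w ∈ V, v ≠ w → ∀ w' ∈ V, v ≠ w' → cnt V v w = cnt V v w' → w = w' := by
    intro w hw hvw w' hw' hvw' e
    by_contra hne
    rcases Cy.total (hV v hv) (hV w hw) (hV w' hw') hvw hne hvw' with h | h
    · have := cnt_lt hV hw h; omega
    · have := cnt_lt hV hw' h; omega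
  have himg : (V.erase v).image (cnt V v) = Finset.range (2 * k) := by
    apply Finset.eq_of_subset_of_card_le
    · intro m hm
      simp only [Finset.mem_image, Finset.mem_erase] at hm
      obtain ⟨w, ⟨hwv, hw⟩, rfl⟩ := hm
      have := cnt_total hV (hV v hv) (hV w hw) hwv.symm
      simp [hv, hw] at this
      simp; omega
    · rw [Finset.card_image_of_injOn, Finset.card_erase_of_mem hv, hc]
      · simp
      · intro w hw w' hw' e
        simp at hw hw'
        exact inj w hw.1 (Ne.symm hw.2) w' hw'.1 (Ne.symm hw'.2) e
  have : m ∈ (V.erase v).image (cnt V v) := by rw [himg]; simpa using hm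
  simp only [Finset.mem_image, Finset.mem_erase] at this
  obtain ⟨w, ⟨hwv, hw⟩, hm'⟩ := this
  refine ⟨w, ⟨hw, hwv.symm, hm'⟩, ?_⟩
  rintro w' ⟨h1, h2, h3⟩
  exact inj _ h1 h2 _ hw hwv.symm (by omega)

lemma SE.rev {V : Finset ℂ} (hV : OnC V) {k : ℕ} (hc : V.card = 2 * k + 1) {p q : ℂ}
    (h : SE V k p q) : cnt V q p = k := by
  obtain ⟨h1, h2, h3, h4⟩ := h
  have := cnt_total hV (hV _ h1) (hV _ h2) h3
  simp [h1, h2] at this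
  omega

lemma SE.cy {V : Finset ℂ} (hV : OnC V) {k : ℕ} (hc : V.card = 2 * k + 1) {u v w : ℂ}
    (h : SE V k u v) (h' : SE V k v w) : Cy u v w := by
  have h2 := h.rev hV hc
  obtain ⟨a1, a2, a3, a4⟩ := h
  obtain ⟨b1, b2, b3, b4⟩ := h'
  have huw : u ≠ w := by rintro rfl; omega
  rcases Cy.total (hV _ b1) (hV _ a1) (hV _ b2) a3.symm huw b3 with h | h
  · have := cnt_lt hV a1 h; omega
  · unfold Cy at *; grind

/-- the star with vertex set `V` -/
def mkStar (V : Finset ℂ) (k : ℕ) (hV : OnC V) (hc : V.card = 2 * k + 1) (hk : 0 < k) :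
    CyclicPolygon where
  V := V
  E := (V ×ˢ V).filter (fun e => SE V k e.1 e.2)
  nonempty := Finset.card_pos.1 (by omega)
  onCircle := hV
  endmem := by
    intro e he
    simp only [Finset.mem_filter, Finset.mem_product] at he
    exact he.1
  outdeg := by
    intro v hv
    obtain ⟨w, ⟨h1, h2, h3⟩, h4⟩ := exists_cnt hV hc hv (m := k - 1) (by omega)
    refine ⟨w, ?_, ?_⟩
    · simp only [Finset.mem_filter, Finset.mem_product]
      exact ⟨⟨hv, h1⟩, hv, h1, h2, by omega⟩
    · intro y hy
      simp only [Finset.mem_filter, Finset.mem_product] at hy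
      obtain ⟨_, _, a, b, c⟩ := hy
      exact h4 y ⟨a, b, by omega⟩
  indeg := by
    intro v hv
    obtain ⟨w, ⟨h1, h2, h3⟩, h4⟩ := exists_cnt hV hc hv (m := k) (by omega)
    refine ⟨w, ?_, ?_⟩
    · simp only [Finset.mem_filter, Finset.mem_product]
      have := cnt_total hV (hV _ hv) (hV _ h1) h2
      simp [hv, h1] at this
      exact ⟨⟨h1, hv⟩, h1, hv, h2.symm, by omega⟩
    · intro y hy
      simp only [Finset.mem_filter, Finset.mem_product] at hy
      exact h4 y ⟨hy.1.1, hy.2.2.2.1.symm, hy.2.rev hV hc⟩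
  acw := by
    intro u v w h h'
    simp only [Finset.mem_filter, Finset.mem_product] at h h'
    exact (acw_iff (hV _ h.1.1) (hV _ h.1.2) (hV _ h'.1.2)).2 (h.2.cy hV hc h'.2)

lemma mem_mkStar {V : Finset ℂ} {k : ℕ} {hV : OnC V} {hc : V.card = 2 * k + 1} {hk : 0 < k}
    {p q : ℂ} : (p, q) ∈ (mkStar V k hV hc hk).E ↔ SE V k p q := by
  simp only [mkStar, Finset.mem_filter, Finset.mem_product]
  exact ⟨fun h => h.2, fun h => ⟨⟨h.1, h.2.1⟩, h⟩⟩

lemma edge_cy (S : CyclicPolygon) {u v w : ℂ} (h : (u, v) ∈ S.E) (h' : (v, w) ∈ S.E) :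
    Cy u v w :=
  (acw_iff (S.onCircle _ (S.endmem _ h).1) (S.onCircle _ (S.endmem _ h).2)
    (S.onCircle _ (S.endmem _ h').2)).1 (S.acw u v w h h')

lemma edge_ne (S : CyclicPolygon) {u v : ℂ} (h : (u, v) ∈ S.E) : u ≠ v := by
  obtain ⟨w, hw, _⟩ := S.outdeg v (S.endmem _ h).2
  exact (edge_cy S h hw).ne.1

lemma edgeLength_eq (S : CyclicPolygon) {u v : ℂ} (hu : u ∈ S.V) (hv : v ∈ S.V) (h : u ≠ v) :
    edgeLength S u v = cnt S.V u v + 1 := by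
  unfold edgeLength cnt
  congr 1
  rw [← Set.ncard_coe_finset]
  congr 1
  ext x
  simp only [Set.mem_inter_iff, Finset.mem_coe, Finset.coe_filter, Set.mem_ofPred_eq]
  refine and_congr_right fun hx => ?_
  exact mem_arcOO_iff (S.onCircle _ hu) (S.onCircle _ hv) (S.onCircle _ hx) h

lemma kstar_edge {S : CyclicPolygon} {k : ℕ} (hS : IsKStar S k) {p q : ℂ} :
    (p, q) ∈ S.E ↔ SE S.V k p q := by
  have key : ∀ p q, (p, q) ∈ S.E → SE S.V k p q := by
    intro p q h
    have h1 := S.endmem _ h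
    have := hS.2 _ h
    rw [edgeLength_eq S h1.1 h1.2 (edge_ne S h)] at this
    exact ⟨h1.1, h1.2, edge_ne S h, this⟩
  refine ⟨key p q, fun h => ?_⟩
  obtain ⟨w, hw, _⟩ := S.outdeg p h.1
  have h2 := key _ _ hw
  have hk := h.2.2.2
  have hle := cnt_total S.onCircle (S.onCircle _ h.1) (S.onCircle _ h.2.1) h.2.2.1
  have hc := hS.1
  simp only [h.1, h.2.1, if_true] at hle
  obtain ⟨_, _, hu⟩ := exists_cnt S.onCircle hS.1 h.1 (m := cnt S.V p q) (by omega)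
  have e1 := hu q ⟨h.2.1, h.2.2.1, rfl⟩
  have e2 := hu w ⟨h2.2.1, h2.2.2.1, by have := h2.2.2.2; omega⟩
  rw [e1, ← e2]; exact hw

lemma mkStar_isStar {V : Finset ℂ} {k : ℕ} (hV : OnC V) (hc : V.card = 2 * k + 1) (hk : 0 < k) :
    IsStar (mkStar V k hV hc hk) := by
  refine ⟨k, hk, hc, ?_⟩
  rintro ⟨p, q⟩ h
  have h' := mem_mkStar.1 h
  have := edgeLength_eq (mkStar V k hV hc hk) (u := p) (v := q) h'.1 h'.2.1 h'.2.2.1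
  exact this.trans h'.2.2.2

lemma next_edge (S : CyclicPolygon) {v : ℂ} (hv : v ∈ S.V) : (v, S.next v) ∈ S.E := by
  obtain ⟨w, hw, _⟩ := S.outdeg v hv
  have : ∃ w, (v, w) ∈ S.E := ⟨w, hw⟩
  unfold CyclicPolygon.next
  rw [dif_pos this]; exact this.choose_spec

lemma prev_edge (S : CyclicPolygon) {v : ℂ} (hv : v ∈ S.V) : (S.prev v, v) ∈ S.E := by
  obtain ⟨w, hw, _⟩ := S.indeg v hv
  have : ∃ w, (w, v) ∈ S.E := ⟨w, hw⟩
  unfold CyclicPolygon.prev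
  rw [dif_pos this]; exact this.choose_spec

lemma next_unique (S : CyclicPolygon) {v w w' : ℂ} (h : (v, w) ∈ S.E) (h' : (v, w') ∈ S.E) :
    w = w' := (S.outdeg v (S.endmem _ h).1).unique h h'

lemma prev_unique (S : CyclicPolygon) {v w w' : ℂ} (h : (w, v) ∈ S.E) (h' : (w', v) ∈ S.E) :
    w = w' := (S.indeg v (S.endmem _ h).2).unique h h'

/-- `x` lies strictly inside the wedge of `S` at `v` -/
def Wd (S : CyclicPolygon) (v x : ℂ) : Prop :=
  v ∈ S.V ∧ ‖x‖ = 1 ∧ Cy v (S.next v) x ∧ Cy v x (S.prev v)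

lemma splitsVertex_iff (S : CyclicPolygon) {v x : ℂ} (hx : ‖x‖ = 1) (hxv : x ≠ v) :
    SplitsVertexAngle S v x ↔ Wd S v x := by
  unfold SplitsVertexAngle Wd
  refine and_congr_right fun hv => ?_
  have h1 := next_edge S hv
  have h2 := prev_edge S hv
  have := splits_iff (S.onCircle _ (S.endmem _ h2).1) (S.onCircle _ hv)
    (S.onCircle _ (S.endmem _ h1).2) hx (edge_cy S h2 h1) hxv
  unfold SplitsAngle3 at this
  rw [this]; simp [hx]

lemma linkable_iff (S T : CyclicPolygon) {u v : ℂ} :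
    LinkablePair S T u v ↔ Wd S u v ∧ Wd T v u := by
  unfold LinkablePair
  constructor
  · rintro ⟨h1, h2, h3⟩
    have a := S.onCircle _ h2.1
    have b := T.onCircle _ h3.1
    exact ⟨(splitsVertex_iff S b h1.symm).1 h2, (splitsVertex_iff T a h1).1 h3⟩
  · rintro ⟨h1, h2⟩
    have hne : u ≠ v := h1.2.2.2.ne.1
    exact ⟨hne, (splitsVertex_iff S h1.2.1 hne.symm).2 h1, (splitsVertex_iff T h2.2.1 hne).2 h2⟩

lemma card_E (S : CyclicPolygon) : S.E.card = S.V.card := by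
  apply Finset.card_bij (fun e _ => e.1)
  · intro e he; exact (S.endmem e he).1
  · rintro ⟨a, b⟩ h ⟨c, d⟩ h' e
    simp only at e
    subst e
    rw [next_unique S h h']
  · intro v hv
    exact ⟨(v, S.next v), next_edge S hv, rfl⟩

/-- `pq` is a weak bisector of the `2k+1` points `V` -/
def Bis (V : Finset ℂ) (k : ℕ) (p q : ℂ) : Prop :=
  ‖p‖ = 1 ∧ ‖q‖ = 1 ∧ p ≠ q ∧ cnt V p q ≤ k ∧ cnt V q p ≤ k

lemma Bis.symm {V : Finset ℂ} {k : ℕ} {p q : ℂ} (h : Bis V k p q) : Bis V k q p :=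
  ⟨h.2.1, h.1, h.2.2.1.symm, h.2.2.2.2, h.2.2.2.1⟩

lemma SE.bis {V : Finset ℂ} (hV : OnC V) {k : ℕ} (hc : V.card = 2 * k + 1) {p q : ℂ}
    (h : SE V k p q) : Bis V k p q := by
  have h1 := h.rev hV hc
  exact ⟨hV _ h.1, hV _ h.2.1, h.2.2.1, by have := h.2.2.2; omega, h1.le⟩

lemma Bis.edge {V : Finset ℂ} (hV : OnC V) {k : ℕ} (hc : V.card = 2 * k + 1) {p q : ℂ}
    (h : Bis V k p q) (hp : p ∈ V) (hq : q ∈ V) : SE V k p q ∨ SE V k q p := by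
  obtain ⟨_, _, h1, h2, h3⟩ := h
  have := cnt_total hV (hV _ hp) (hV _ hq) h1
  simp only [hp, hq, if_true] at this
  by_cases e : cnt V p q + 1 = k
  · exact Or.inl ⟨hp, hq, h1, e⟩
  · exact Or.inr ⟨hq, hp, h1.symm, by omega⟩

lemma Bis.cross {V : Finset ℂ} (hV : OnC V) {k : ℕ} (hc : V.card = 2 * k + 1) {p q r s : ℂ}
    (h : Bis V k p q) (h' : Bis V k r s) (h1 : Cy p q r) (h2 : Cy r s p) : False := by
  -- order p q r s
  obtain ⟨np, nq, h3, h4, h5⟩ := h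
  obtain ⟨nr, ns, h6, h7, h8⟩ := h'
  have c1 := cnt_total hV np nq h3
  have c2 := cnt_split hV np (show Cy s p r by unfold Cy at *; grind)
  have c3 := cnt_split hV nq h1
  split_ifs at * <;> omega

section star
variable {S : CyclicPolygon} {k : ℕ}

lemma star_cnt (hS : IsKStar S k) {v : ℂ} (hv : v ∈ S.V) :
    cnt S.V v (S.next v) + 1 = k ∧ cnt S.V v (S.prev v) = k :=
  ⟨((kstar_edge hS).1 (next_edge S hv)).2.2.2,
    ((kstar_edge hS).1 (prev_edge S hv)).rev S.onCircle hS.1⟩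

lemma next_mem {v : ℂ} (hv : v ∈ S.V) : S.next v ∈ S.V := (S.endmem _ (next_edge S hv)).2
lemma prev_mem {v : ℂ} (hv : v ∈ S.V) : S.prev v ∈ S.V := (S.endmem _ (prev_edge S hv)).1

lemma Wd.not_mem (hS : IsKStar S k) {v x : ℂ} (h : Wd S v x) : x ∉ S.V := by
  intro hx
  have c := star_cnt hS h.1
  have := cnt_lt S.onCircle (next_mem h.1) h.2.2.1
  have := cnt_lt S.onCircle hx h.2.2.2
  omega

lemma Wd.cnt (hS : IsKStar S k) {v x : ℂ} (h : Wd S v x) :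
    cnt S.V v x = k ∧ cnt S.V x v = k := by
  have c := star_cnt hS h.1
  have := cnt_lt S.onCircle (next_mem h.1) h.2.2.1
  have := cnt_le S.onCircle h.2.1 h.2.2.2
  have t := cnt_total S.onCircle (S.onCircle _ h.1) h.2.1 h.2.2.2.ne.1
  have hc := hS.1
  simp only [h.1, h.not_mem hS, if_true, if_false] at t
  omega

lemma Wd.bis (hS : IsKStar S k) {v x : ℂ} (h : Wd S v x) : Bis S.V k v x :=
  ⟨S.onCircle _ h.1, h.2.1, h.2.2.2.ne.1, (h.cnt hS).1.le, (h.cnt hS).2.le⟩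

lemma Bis.wd (hS : IsKStar S k) {v x : ℂ} (h : Bis S.V k v x) (hv : v ∈ S.V) (hx : x ∉ S.V) :
    Wd S v x := by
  obtain ⟨nv, nx, h1, h2, h3⟩ := h
  have c := star_cnt hS hv
  have t := cnt_total S.onCircle nv nx h1
  have hc := hS.1
  simp only [hv, hx, if_true, if_false] at t
  refine ⟨hv, nx, ?_, ?_⟩
  · have hn := next_mem hv
    rcases Cy.total nv (S.onCircle _ hn) nx (edge_ne S (next_edge S hv))
      (fun e => hx (e ▸ hn)) h1 with h | h
    · exact h
    · have := cnt_le S.onCircle nx h; omega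
  · have hn := prev_mem hv
    rcases Cy.total nv nx (S.onCircle _ hn) h1 (fun e => hx (e ▸ hn))
      (edge_ne S (prev_edge S hv)).symm with h | h
    · exact h
    · have := cnt_lt S.onCircle hn h; omega

lemma exists_bis (hS : IsKStar S k) {p : ℂ} (hp : ‖p‖ = 1) :
    ∃ q ∈ S.V, Bis S.V k p q := by
  by_cases hpV : p ∈ S.V
  · exact ⟨S.next p, next_mem hpV, ((kstar_edge hS).1 (next_edge S hpV)).bis S.onCircle hS.1⟩
  · obtain ⟨b, hb, hmin⟩ := Finset.exists_min_image S.V (posArc p) S.nonempty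
    have hq := next_mem hb
    have hc := next_mem hq
    refine ⟨S.next b, hq, (Wd.bis hS ⟨hq, hp, ?_⟩).symm⟩
    have e1 := next_edge S hb
    have e2 := next_edge S hq
    have cy := edge_cy S e1 e2
    have hpr : S.prev (S.next b) = b := prev_unique S (prev_edge S hq) e1
    rw [hpr]
    have nb : b ≠ p := fun e => hpV (e ▸ hb)
    have nc : S.next (S.next b) ≠ p := fun e => hpV (e ▸ hc)
    have h1 : Cy p b (S.next (S.next b)) := by
      rcases Cy.total hp (S.onCircle _ hb) (S.onCircle _ hc) nb.symm cy.ne.2.2 nc.symm with h | h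
      · exact h
      · have := (posArc_lt_iff hp (S.onCircle _ hc) (S.onCircle _ hb) nc nb).2 h
        have := hmin _ hc
        linarith
    unfold Cy at *
    constructor <;> grind

end star

section decomp
variable {P : CyclicPolygon} {D : Set (Sym2 ℂ)} {𝒮 : Finset CyclicPolygon}

lemma D_wd (hd : IsStarDecomp P D 𝒮) {u v : ℂ} (h : s(u, v) ∈ D) : Wd P u v :=
  ((linkable_iff P P).1 (hd.1 u v h)).1

lemma not_wd_D (hd : IsStarDecomp P D 𝒮) {S : CyclicPolygon} (hS : S ∈ 𝒮) {v x : ℂ}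
    (h : s(v, x) ∈ D) : ¬ Wd S v x := by
  intro hw
  refine hd.2.2.2.2.2 S hS _ _ _ (prev_edge S hw.1) (next_edge S hw.1) ⟨x, h, ?_⟩
  exact (splits_iff (S.onCircle _ (prev_mem hw.1)) (S.onCircle _ hw.1)
    (S.onCircle _ (next_mem hw.1)) hw.2.1 (edge_cy S (prev_edge S hw.1) (next_edge S hw.1))
    hw.2.2.2.ne.1.symm).2 hw.2.2

lemma out_P (hd : IsStarDecomp P D 𝒮) {S : CyclicPolygon} (hS : S ∈ 𝒮) {v w : ℂ}
    (h : (v, w) ∈ S.E) : w = P.next v ∨ (s(v, w) ∈ D ∧ Wd P v w) := by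
  rcases hd.2.2.1 S hS h with h | h
  · exact Or.inl (next_unique P h (next_edge P (P.endmem _ h).1))
  · exact Or.inr ⟨h, D_wd hd h⟩

lemma in_P (hd : IsStarDecomp P D 𝒮) {S : CyclicPolygon} (hS : S ∈ 𝒮) {v w : ℂ}
    (h : (w, v) ∈ S.E) : w = P.prev v ∨ (s(v, w) ∈ D ∧ Wd P v w) := by
  rcases hd.2.2.1 S hS h with h | h
  · exact Or.inl (prev_unique P h (prev_edge P (P.endmem _ h).2))
  · have h' : s(v, w) ∈ D := by rw [Sym2.eq_swap]; exact h
    exact Or.inr ⟨h', D_wd hd h'⟩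

lemma wd_sub (hd : IsStarDecomp P D 𝒮) {S : CyclicPolygon} (hS : S ∈ 𝒮) {v x : ℂ}
    (h : Wd S v x) : Wd P v x := by
  refine ⟨(hd.2.1 S hS).2 h.1, h.2.1, ?_, ?_⟩
  · rcases out_P hd hS (next_edge S h.1) with e | ⟨_, e⟩
    · rw [← e]; exact h.2.2.1
    · exact e.2.2.1.trans h.2.2.1
  · rcases in_P hd hS (prev_edge S h.1) with e | ⟨_, e⟩
    · rw [← e]; exact h.2.2.2
    · exact h.2.2.2.trans e.2.2.2

lemma not_wd_out (hd : IsStarDecomp P D 𝒮) {S T : CyclicPolygon} (hS : S ∈ 𝒮) (hT : T ∈ 𝒮)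
    {v w : ℂ} (h : (v, w) ∈ T.E) : ¬ Wd S v w := by
  intro hw
  rcases out_P hd hT h with e | ⟨e, _⟩
  · have := (wd_sub hd hS hw).2.2.1.ne.2.1
    exact this e.symm
  · exact not_wd_D hd hS e hw

lemma not_wd_in (hd : IsStarDecomp P D 𝒮) {S T : CyclicPolygon} (hS : S ∈ 𝒮) (hT : T ∈ 𝒮)
    {v w : ℂ} (h : (w, v) ∈ T.E) : ¬ Wd S v w := by
  intro hw
  rcases in_P hd hT h with e | ⟨e, _⟩
  · have := (wd_sub hd hS hw).2.2.2.ne.2.1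
    exact this e
  · exact not_wd_D hd hS e hw

lemma nonoverlap (hd : IsStarDecomp P D 𝒮) {S T : CyclicPolygon} (hS : S ∈ 𝒮) (hT : T ∈ 𝒮)
    (hne : S ≠ T) {v x : ℂ} (h1 : Wd S v x) (h2 : Wd T v x) : False := by
  have hn : S.next v ≠ T.next v := fun e =>
    hd.2.2.2.2.1 S hS T hT hne _ (next_edge S h1.1) (e ▸ next_edge T h2.1)
  have nS := S.onCircle _ (next_mem h1.1)
  have nT := T.onCircle _ (next_mem h2.1)
  rcases Cy.total (S.onCircle _ h1.1) nS nT (edge_ne S (next_edge S h1.1)) hn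
    (edge_ne T (next_edge T h2.1)) with h | h
  · exact not_wd_out hd hS hT (next_edge T h2.1) ⟨h1.1, nT, h, h2.2.2.1.trans h1.2.2.2⟩
  · exact not_wd_out hd hT hS (next_edge S h1.1) ⟨h2.1, nS, h, h1.2.2.1.trans h2.2.2.2⟩

/-- the reversed edge: if an edge `uw` of `S` is a bisector of `T` with an endpoint in `T`,
then `wu` is an edge of `T`. -/
lemma rev_edge (hd : IsStarDecomp P D 𝒮) {S T : CyclicPolygon} (hS : S ∈ 𝒮) (hT : T ∈ 𝒮)
    (hne : S ≠ T) {l : ℕ} (hl : IsKStar T l) {u w : ℂ} (h : (u, w) ∈ S.E)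
    (hb : Bis T.V l u w) (hm : u ∈ T.V ∨ w ∈ T.V) : (w, u) ∈ T.E := by
  have hu : u ∈ T.V := by
    by_contra hu
    have hw : w ∈ T.V := by tauto
    exact not_wd_in hd hT hS h (hb.symm.wd hl hw hu)
  have hw : w ∈ T.V := by
    by_contra hw
    exact not_wd_out hd hT hS h (hb.wd hl hu hw)
  rcases hb.edge T.onCircle hl.1 hu hw with e | e
  · exact absurd ((kstar_edge hl).2 e) (hd.2.2.2.2.1 S hS T hT hne _ h)
  · exact (kstar_edge hl).2 e

/-- `T` bisects `S` from `u` before the wedge of `S` at `u` -/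
def Abv (S T : CyclicPolygon) (l : ℕ) (u : ℂ) : Prop :=
  ∃ q ∈ T.V, Bis T.V l u q ∧ (q = S.next u ∨ Cy u q (S.next u))

lemma not_abv (hd : IsStarDecomp P D 𝒮) {S T : CyclicPolygon} (hS : S ∈ 𝒮) (hT : T ∈ 𝒮)
    {l : ℕ} (hl : IsKStar T l)
    (hno : ∀ u v, Wd S u v → ¬ Wd T v u) {u : ℂ} (hu : u ∈ S.V) (h : ¬ Abv S T l u) :
    ∃ q ∈ T.V, Bis T.V l u q ∧ (q = S.prev u ∨ Cy u (S.prev u) q) := by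
  obtain ⟨q, hq, hb⟩ := exists_bis hl (S.onCircle _ hu)
  refine ⟨q, hq, hb, ?_⟩
  by_contra hcon
  push Not at hcon
  have hw : Wd S u q := by
    refine ⟨hu, hb.2.1, ?_, ?_⟩
    · have hn := next_mem hu
      by_cases e : S.next u = q
      · exact absurd ⟨q, hq, hb, Or.inl e.symm⟩ h
      rcases Cy.total hb.1 (S.onCircle _ hn) hb.2.1 (edge_ne S (next_edge S hu)) e hb.2.2.1 with c | c
      · exact c
      · exact absurd ⟨q, hq, hb, Or.inr c⟩ h
    · have hn := prev_mem hu
      rcases Cy.total hb.1 hb.2.1 (S.onCircle _ hn) hb.2.2.1 hcon.1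
        (edge_ne S (prev_edge S hu)).symm with c | c
      · exact c
      · exact absurd c hcon.2
  by_cases huT : u ∈ T.V
  · rcases hb.edge T.onCircle hl.1 huT hq with e | e
    · exact not_wd_out hd hS hT ((kstar_edge hl).2 e) hw
    · exact not_wd_in hd hS hT ((kstar_edge hl).2 e) hw
  · exact hno _ _ hw (hb.symm.wd hl hq huT)

lemma abv_alt (hd : IsStarDecomp P D 𝒮) {S T : CyclicPolygon} (hS : S ∈ 𝒮) (hT : T ∈ 𝒮)
    (hne : S ≠ T) {l : ℕ} (hl : IsKStar T l)
    (hno : ∀ u v, Wd S u v → ¬ Wd T v u) {u : ℂ} (hu : u ∈ S.V) :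
    Abv S T l u ↔ ¬ Abv S T l (S.next u) := by
  have hw := next_mem hu
  have e1 := next_edge S hu
  have e2 := next_edge S hw
  have hpr : S.prev (S.next u) = u := prev_unique S (prev_edge S hw) e1
  constructor
  · rintro ⟨q, hq, hb, hc⟩ ⟨q', hq', hb', hc'⟩
    have cy := edge_cy S e1 e2
    have cy2 : Cy (S.next u) q' u := by
      rcases hc' with c | c
      · rw [c]; exact cy.rot
      · exact c.trans cy.rot
    rcases hc with c | c
    · subst c
      have er := rev_edge hd hS hT hne hl e1 hb (Or.inr hq)
      have hwT := (T.endmem _ er).1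
      rcases hb'.edge T.onCircle hl.1 hwT hq' with e | e
      · have := next_unique T ((kstar_edge hl).2 e) er
        exact cy2.ne.2.1 this
      · have := edge_cy T ((kstar_edge hl).2 e) er
        unfold Cy at *; grind
    · refine hb.cross T.onCircle hl.1 hb' c.rot.rot.rot ?_
      exact cy2
  · intro h
    by_contra h'
    obtain ⟨q, hq, hb, hc⟩ := not_abv hd hS hT hl hno hu h'
    obtain ⟨q', hq', hb', hc'⟩ := not_abv hd hS hT hl hno hw h
    rw [hpr] at hc'
    have cy := edge_cy S (prev_edge S hu) e1
    have cy2 : Cy u (S.next u) q := by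
      rcases hc with c | c
      · rw [c]; exact cy.rot
      · exact cy.rot.trans c
    rcases hc' with c | c
    · subst c
      have er := rev_edge hd hS hT hne hl e1 hb'.symm (Or.inl hq')
      rcases hb.edge T.onCircle hl.1 hq' hq with e | e
      · have := edge_cy T er ((kstar_edge hl).2 e)
        unfold Cy at *; grind
      · have := prev_unique T ((kstar_edge hl).2 e) er
        exact cy2.ne.2.1 this.symm
    · refine hb'.symm.cross T.onCircle hl.1 hb.symm (?_ : Cy q' (S.next u) q) ?_
      · unfold Cy at *; grind
      · unfold Cy at *; grind

lemma exists_linkable (hd : IsStarDecomp P D 𝒮) {S T : CyclicPolygon} (hS : S ∈ 𝒮) (hT : T ∈ 𝒮)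
    (hne : S ≠ T) : ∃ u v, Wd S u v ∧ Wd T v u := by
  by_contra hcon
  push Not at hcon
  obtain ⟨⟨k, hk, hkS⟩, _⟩ := hd.2.1 S hS
  obtain ⟨⟨l, hl0, hl⟩, _⟩ := hd.2.1 T hT
  have alt := fun u hu => abv_alt hd hS hT hne hl hcon (u := u) hu
  have key : (S.V.filter (fun u => Abv S T l u)).card =
      (S.V.filter (fun u => ¬ Abv S T l u)).card := by
    apply Finset.card_bij (fun u _ => S.next u)
    · intro u hu
      rw [Finset.mem_filter] at hu ⊢
      exact ⟨next_mem hu.1, (alt u hu.1).1 hu.2⟩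
    · intro u hu u' hu' e
      rw [Finset.mem_filter] at hu hu'
      exact prev_unique S (next_edge S hu.1) (e ▸ next_edge S hu'.1)
    · intro w hw
      rw [Finset.mem_filter] at hw
      have e : S.next (S.prev w) = w :=
        next_unique S (next_edge S (prev_mem hw.1)) (prev_edge S hw.1)
      refine ⟨S.prev w, ?_, e⟩
      rw [Finset.mem_filter]
      refine ⟨prev_mem hw.1, (alt _ (prev_mem hw.1)).2 ?_⟩
      rw [e]; exact hw.2
  have := Finset.card_filter_add_card_filter_not (s := S.V) (fun u => Abv S T l u)
  have := hkS.1
  omega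

end decomp

/-- Two crossing chords `ac`, `bd`, each bisecting both odd sets `X`, `Y` and having exactly
one endpoint in each of them. -/
structure Cfg (a b c d : ℂ) (X Y : Finset ℂ) (k l : ℕ) : Prop where
  X1 : OnC X
  Y1 : OnC Y
  na : ‖a‖ = 1
  nb : ‖b‖ = 1
  nc : ‖c‖ = 1
  nd : ‖d‖ = 1
  abc : Cy a b c
  cda : Cy c d a
  cX : X.card = 2 * k + 1
  cY : Y.card = 2 * l + 1
  acX : a ∈ X ↔ c ∉ X
  bdX : b ∈ X ↔ d ∉ X
  aXY : a ∈ X ↔ a ∉ Y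
  bXY : b ∈ X ↔ b ∉ Y
  cXY : c ∈ X ↔ c ∉ Y
  dXY : d ∈ X ↔ d ∉ Y
  Xac : cnt X a c = k
  Xca : cnt X c a = k
  Xbd : cnt X b d = k
  Xdb : cnt X d b = k
  Yac : cnt Y a c = l
  Yca : cnt Y c a = l
  Ybd : cnt Y b d = l
  Ydb : cnt Y d b = l

/-- the spliced vertex set -/
def Wset (a b c d : ℂ) (X Y : Finset ℂ) : Finset ℂ :=
  {a, b, c, d} ∪ X.filter (fun x => Cy a x b ∨ Cy c x d) ∪ Y.filter (fun x => Cy b x c ∨ Cy d x a)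

lemma Wset_rot (a b c d : ℂ) (X Y : Finset ℂ) : Wset b c d a Y X = Wset a b c d X Y := by
  ext x
  simp only [Wset, Finset.mem_union, Finset.mem_filter, Finset.mem_insert, Finset.mem_singleton]
  tauto

section cfg
variable {a b c d : ℂ} {X Y : Finset ℂ} {k l : ℕ}

lemma Cfg.rot (h : Cfg a b c d X Y k l) : Cfg b c d a Y X l k where
  X1 := h.Y1
  Y1 := h.X1
  na := h.nb
  nb := h.nc
  nc := h.nd
  nd := h.na
  abc := by have := h.abc; have := h.cda; unfold Cy at *; grind
  cda := by have := h.abc; have := h.cda; unfold Cy at *; grind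
  cX := h.cY
  cY := h.cX
  acX := by have := h.bdX; have := h.bXY; have := h.dXY; tauto
  bdX := by have := h.acX; have := h.aXY; have := h.cXY; tauto
  aXY := by have := h.bXY; tauto
  bXY := by have := h.cXY; tauto
  cXY := by have := h.dXY; tauto
  dXY := by have := h.aXY; tauto
  Xac := h.Ybd
  Xca := h.Ydb
  Xbd := h.Yca
  Xdb := h.Yac
  Yac := h.Xbd
  Yca := h.Xdb
  Ybd := h.Xca
  Ydb := h.Xac

lemma Cfg.swap (h : Cfg a b c d X Y k l) : Cfg a b c d Y X l k where
  X1 := h.Y1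
  Y1 := h.X1
  na := h.na
  nb := h.nb
  nc := h.nc
  nd := h.nd
  abc := h.abc
  cda := h.cda
  cX := h.cY
  cY := h.cX
  acX := by have := h.acX; have := h.aXY; have := h.cXY; tauto
  bdX := by have := h.bdX; have := h.bXY; have := h.dXY; tauto
  aXY := by have := h.aXY; tauto
  bXY := by have := h.bXY; tauto
  cXY := by have := h.cXY; tauto
  dXY := by have := h.dXY; tauto
  Xac := h.Yac
  Xca := h.Yca
  Xbd := h.Ybd
  Xdb := h.Ydb
  Yac := h.Xac
  Yca := h.Xca
  Ybd := h.Xbd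
  Ydb := h.Xdb

lemma Cfg.bcd (h : Cfg a b c d X Y k l) : Cy b c d := h.rot.abc
lemma Cfg.dab (h : Cfg a b c d X Y k l) : Cy d a b := h.rot.cda

lemma Cfg.W1 (h : Cfg a b c d X Y k l) : OnC (Wset a b c d X Y) := by
  intro x hx
  simp only [Wset, Finset.mem_union, Finset.mem_filter, Finset.mem_insert,
    Finset.mem_singleton] at hx
  rcases hx with ((rfl | rfl | rfl | rfl) | hx) | hx
  · exact h.na
  · exact h.nb
  · exact h.nc
  · exact h.nd
  · exact h.X1 _ hx.1
  · exact h.Y1 _ hx.1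

lemma memW : a ∈ Wset a b c d X Y ∧ b ∈ Wset a b c d X Y ∧ c ∈ Wset a b c d X Y ∧
    d ∈ Wset a b c d X Y := by
  simp [Wset]

/-- weakly between -/
def In (a p b : ℂ) : Prop := p = a ∨ p = b ∨ Cy a p b

/-- counts on sub-arcs of `(a,b)` agree with `X` -/
lemma Cfg.cnt_sub (h : Cfg a b c d X Y k l) {p q : ℂ} (hsub : ∀ x, Cy p x q → Cy a x b) :
    cnt (Wset a b c d X Y) p q = cnt X p q := by
  unfold cnt
  congr 1
  ext x
  have h1 := h.abc
  have h2 := h.cda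
  have h3 := h.bcd
  have h4 := h.dab
  simp only [Wset, Finset.mem_union, Finset.mem_filter, Finset.mem_insert,
    Finset.mem_singleton]
  constructor
  · rintro ⟨hx, hc⟩
    have hc' := hsub x hc
    refine ⟨?_, hc⟩
    rcases hx with ((rfl | rfl | rfl | rfl) | hx) | hx
    · exact absurd rfl hc'.ne.1
    · exact absurd rfl hc'.ne.2.1
    · unfold Cy at *; grind
    · unfold Cy at *; grind
    · exact hx.1
    · exfalso; unfold Cy at *; grind
  · rintro ⟨hx, hc⟩
    exact ⟨Or.inl (Or.inr ⟨hx, Or.inl (hsub x hc)⟩), hc⟩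

lemma Cfg.cnt_ab (h : Cfg a b c d X Y k l) : cnt (Wset a b c d X Y) a b = cnt X a b :=
  h.cnt_sub fun _ h => h

lemma Cfg.cnt_bc (h : Cfg a b c d X Y k l) : cnt (Wset a b c d X Y) b c = cnt Y b c := by
  rw [← Wset_rot]; exact h.rot.cnt_ab

lemma Cfg.cnt_cd (h : Cfg a b c d X Y k l) : cnt (Wset a b c d X Y) c d = cnt X c d := by
  rw [← Wset_rot]; exact h.rot.cnt_bc

lemma Cfg.cnt_da (h : Cfg a b c d X Y k l) : cnt (Wset a b c d X Y) d a = cnt Y d a := by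
  rw [← Wset_rot]; exact h.rot.cnt_cd

lemma Cfg.ac (h : Cfg a b c d X Y k l) : a ≠ c := h.abc.ne.2.2

lemma ite_not' {p q : Prop} [Decidable p] [Decidable q] (h : p ↔ ¬ q) :
    (if p then 1 else 0 : ℕ) + (if q then 1 else 0) = 1 := by
  split_ifs <;> tauto

/-- main count -/
lemma Cfg.counts (h : Cfg a b c d X Y k l) :
    ∃ m, 0 < m ∧ (Wset a b c d X Y).card = 2 * m + 1 ∧
      m + cnt X b c + (if b ∈ X then 1 else 0) + (if c ∈ X then 1 else 0) = 2 + k + cnt Y b c ∧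
      cnt (Wset a b c d X Y) a c + 1 = m + (if c ∈ X then 1 else 0) := by
  have W1 := h.W1
  have t := cnt_total W1 h.na h.nc h.ac
  have s1 := cnt_split W1 h.nb h.abc
  have s2 := cnt_split W1 h.nd h.cda
  rw [h.cnt_ab, h.cnt_bc] at s1
  rw [h.cnt_cd, h.cnt_da] at s2
  obtain ⟨m1, m2, m3, m4⟩ := memW (a := a) (b := b) (c := c) (d := d) (X := X) (Y := Y)
  simp only [m1, m2, m3, m4, if_true] at t s1 s2
  have x1 := cnt_split h.X1 h.nb h.abc
  have x2 := cnt_split h.X1 h.nd h.cda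
  have x3 := cnt_split h.X1 h.nc h.bcd
  have x4 := cnt_split h.X1 h.na h.dab
  have y1 := cnt_split h.Y1 h.nb h.abc
  have y2 := cnt_split h.Y1 h.nd h.cda
  have y3 := cnt_split h.Y1 h.nc h.bcd
  have y4 := cnt_split h.Y1 h.na h.dab
  rw [h.Xac] at x1
  rw [h.Xca] at x2
  rw [h.Xbd] at x3
  rw [h.Xdb] at x4
  rw [h.Yac] at y1
  rw [h.Yca] at y2
  rw [h.Ybd] at y3
  rw [h.Ydb] at y4
  have i1 := ite_not' h.acX
  have i2 := ite_not' h.bdX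
  have i3 := ite_not' h.aXY
  have i4 := ite_not' h.bXY
  have i5 := ite_not' h.cXY
  have i6 := ite_not' h.dXY
  refine ⟨2 + k + cnt Y b c - cnt X b c - (if b ∈ X then 1 else 0) - (if c ∈ X then 1 else 0),
    ?_, ?_, ?_, ?_⟩ <;> omega

lemma Cfg.edge_new (h : Cfg a b c d X Y k l) {m : ℕ} (hm : (Wset a b c d X Y).card = 2 * m + 1)
    (hc : c ∉ X) : SE (Wset a b c d X Y) m a c := by
  obtain ⟨m', _, h1, h2, h3⟩ := h.counts
  have : m' = m := by omega
  subst this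
  obtain ⟨m1, m2, m3, m4⟩ := memW (a := a) (b := b) (c := c) (d := d) (X := X) (Y := Y)
  refine ⟨m1, m3, h.ac, ?_⟩
  simp only [hc, if_false] at h3
  omega

lemma In.memW {p : ℂ} (h : In a p b) (hp : p ∈ X) : p ∈ Wset a b c d X Y := by
  simp only [Wset, Finset.mem_union, Finset.mem_filter, Finset.mem_insert,
    Finset.mem_singleton]
  rcases h with h | h | h
  · simp [h]
  · simp [h]
  · exact Or.inl (Or.inr ⟨hp, Or.inl h⟩)

lemma Cfg.edge_old (h : Cfg a b c d X Y k l) {m : ℕ} (hm : (Wset a b c d X Y).card = 2 * m + 1)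
    {p q : ℂ} (hpq : SE X k p q) (hp : In a p b) (hq : In c q d) :
    SE (Wset a b c d X Y) m p q := by
  obtain ⟨m', _, h1, h2, _⟩ := h.counts
  have : m' = m := by omega
  subst this
  obtain ⟨pX, qX, hne, hk⟩ := hpq
  have np := h.X1 _ pX
  have nq := h.X1 _ qX
  have abc := h.abc
  have cda := h.cda
  have bcd := h.bcd
  have dab := h.dab
  have hpW : p ∈ Wset a b c d X Y := hp.memW pX
  have hqW : q ∈ Wset a b c d X Y := by
    rw [← Wset_rot, ← Wset_rot]; exact hq.memW qX
  obtain ⟨m1, m2, m3, m4⟩ := memW (a := a) (b := b) (c := c) (d := d) (X := X) (Y := Y)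
  refine ⟨hpW, hqW, hne, ?_⟩
  -- from b to q
  have e1 : cnt (Wset a b c d X Y) b q + cnt X b c + (if c ∈ X then 1 else 0) =
      cnt X b q + cnt Y b c + 1 := by
    by_cases hqc : q = c
    · subst hqc
      rw [h.cnt_bc]; simp only [qX, if_true]; omega
    · have cy : Cy b c q := by
        rcases hq with rfl | rfl | hq
        · exact absurd rfl hqc
        · exact bcd
        · unfold Cy at *; grind
      have a1 := cnt_split h.W1 h.nc cy
      have a2 := cnt_split h.X1 h.nc cy
      have a3 : cnt (Wset a b c d X Y) c q = cnt X c q := by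
        rw [← Wset_rot, ← Wset_rot]
        refine h.rot.rot.cnt_sub fun x hx => ?_
        rcases hq with rfl | rfl | hq
        · exact absurd rfl hqc
        · exact hx
        · exact hx.trans hq
      rw [a3, h.cnt_bc] at a1
      simp only [m3, if_true] at a1
      omega
  have e2 : cnt (Wset a b c d X Y) p q + cnt X b q + (if b ∈ X then 1 else 0) =
      cnt X p q + cnt (Wset a b c d X Y) b q + 1 := by
    by_cases hpb : p = b
    · subst hpb
      simp only [pX, if_true]; omega
    · have cy : Cy p b q := by
        unfold In at *
        rcases hp with rfl | rfl | hp <;> rcases hq with rfl | rfl | hq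
        · exact abc
        · unfold Cy at *; grind
        · unfold Cy at *; grind
        · exact absurd rfl hpb
        · exact absurd rfl hpb
        · exact absurd rfl hpb
        · unfold Cy at *; grind
        · unfold Cy at *; grind
        · unfold Cy at *; grind
      have a1 := cnt_split h.W1 h.nb cy
      have a2 := cnt_split h.X1 h.nb cy
      have a3 : cnt (Wset a b c d X Y) p b = cnt X p b := by
        refine h.cnt_sub fun x hx => ?_
        rcases hp with rfl | rfl | hp
        · exact hx
        · exact absurd rfl hpb
        · unfold Cy at *; grind
      rw [a3] at a1
      simp only [m2, if_true] at a1
      omega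
  omega

/-- classification of the bisectors with respect to two crossing bisectors -/
lemma Cfg.class (h : Cfg a b c d X Y k l) {p q : ℂ} (hpq : Bis X k p q) :
    (In a p b ∧ In c q d) ∨ (In c p d ∧ In a q b) ∨ (In b p c ∧ In d q a) ∨
      (In d p a ∧ In b q c) := by
  have bac : Bis X k a c := ⟨h.na, h.nc, h.ac, h.Xac.le, h.Xca.le⟩
  have bbd : Bis X k b d := ⟨h.nb, h.nd, h.rot.ac, h.Xbd.le, h.Xdb.le⟩
  have k1 := fun h1 h2 => hpq.cross h.X1 h.cX bac h1 h2
  have k2 := fun h1 h2 => hpq.cross h.X1 h.cX bac.symm h1 h2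
  have k3 := fun h1 h2 => hpq.symm.cross h.X1 h.cX bac h1 h2
  have k4 := fun h1 h2 => hpq.symm.cross h.X1 h.cX bac.symm h1 h2
  have k5 := fun h1 h2 => hpq.cross h.X1 h.cX bbd h1 h2
  have k6 := fun h1 h2 => hpq.cross h.X1 h.cX bbd.symm h1 h2
  have k7 := fun h1 h2 => hpq.symm.cross h.X1 h.cX bbd h1 h2
  have k8 := fun h1 h2 => hpq.symm.cross h.X1 h.cX bbd.symm h1 h2
  have ne := arg_ne hpq.1 hpq.2.1 hpq.2.2.1
  have abc := h.abc
  have cda := h.cda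
  have bcd := h.bcd
  have dab := h.dab
  have cov : ∀ x : ℂ, ‖x‖ = 1 → (x = a ∨ x = b ∨ x = c ∨ x = d ∨ Cy a x b ∨ Cy b x c ∨ Cy c x d ∨
      Cy d x a) := by
    intro x hx
    by_cases e1 : x = a
    · simp [e1]
    by_cases e2 : x = b
    · simp [e2]
    by_cases e3 : x = c
    · simp [e3]
    by_cases e4 : x = d
    · simp [e4]
    have := arg_ne hx h.na e1
    have := arg_ne hx h.nb e2
    have := arg_ne hx h.nc e3
    have := arg_ne hx h.nd e4
    right; right; right; right
    unfold Cy at *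
    grind
  unfold In
  rcases cov p hpq.1 with e | e | e | e | e | e | e | e <;>
  rcases cov q hpq.2.1 with f | f | f | f | f | f | f | f <;>
  first
  | (simp [e, f]; done)
  | (exfalso; subst e; subst f; exact ne rfl)
  | (exfalso; clear ne; subst e; unfold Cy at *; grind)
  | (exfalso; clear ne; subst f; unfold Cy at *; grind)
  | (exfalso; unfold Cy at *; grind)

end cfg

section splice
variable {a b c d : ℂ} {X Y : Finset ℂ} {k l m n : ℕ}

lemma Cfg.old (h : Cfg a b c d X Y k l) (hm : (Wset a b c d X Y).card = 2 * m + 1)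
    (hn : (Wset a b c d Y X).card = 2 * n + 1) {p q : ℂ} (hpq : SE X k p q) :
    (SE (Wset a b c d X Y) m p q ∧ ((In a p b ∧ In c q d) ∨ (In c p d ∧ In a q b))) ∨
    (SE (Wset a b c d Y X) n p q ∧ ((In b p c ∧ In d q a) ∨ (In d p a ∧ In b q c))) := by
  have r1 : Wset c d a b X Y = Wset a b c d X Y := by rw [← Wset_rot a, ← Wset_rot b]
  have r2 : Wset b c d a X Y = Wset a b c d Y X := by rw [← Wset_rot a]
  have r3 : Wset d a b c X Y = Wset a b c d Y X := by
    rw [← Wset_rot a, ← Wset_rot b, ← Wset_rot c]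
  rcases h.class (hpq.bis h.X1 h.cX) with ⟨e, f⟩ | ⟨e, f⟩ | ⟨e, f⟩ | ⟨e, f⟩
  · exact Or.inl ⟨h.edge_old hm hpq e f, Or.inl ⟨e, f⟩⟩
  · have := h.rot.rot.edge_old (m := m) (by rw [r1]; exact hm) hpq e f
    rw [r1] at this
    exact Or.inl ⟨this, Or.inr ⟨e, f⟩⟩
  · have := h.rot.swap.edge_old (m := n) (by rw [r2]; exact hn) hpq e f
    rw [r2] at this
    exact Or.inr ⟨this, Or.inl ⟨e, f⟩⟩
  · have := h.rot.rot.rot.swap.edge_old (m := n) (by rw [r3]; exact hn) hpq e f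
    rw [r3] at this
    exact Or.inr ⟨this, Or.inr ⟨e, f⟩⟩

lemma In.strict {p q r : ℂ} (h : In p q r) (h1 : q ≠ p) (h2 : q ≠ r) : Cy p q r := by
  exact (h.resolve_left h1).resolve_left h2

lemma mixed_aux {q : ℂ} (abc : Cy a b c) (cda : Cy c d a) (bcd : Cy b c d) (dab : Cy d a b)
    (h1 : Cy a q b ∨ Cy c q d) (h2 : Cy b q c ∨ Cy d q a) : False := by
  unfold Cy at *; grind

/-- the four new directed edges -/
def Nw (a b c d p q : ℂ) : Prop :=
  (p = a ∧ q = c) ∨ (p = c ∧ q = a) ∨ (p = b ∧ q = d) ∨ (p = d ∧ q = b)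

lemma Nw.symm {p q : ℂ} (h : Nw a b c d p q) : Nw a b c d q p := by
  unfold Nw at *; tauto

variable {P : CyclicPolygon} {D : Set (Sym2 ℂ)} {𝒮 : Finset CyclicPolygon}

set_option maxHeartbeats 4000000 in
lemma nosplit (hd : IsStarDecomp P D 𝒮) {S T : CyclicPolygon} (hS : S ∈ 𝒮) (hT : T ∈ 𝒮)
    (hkS : IsKStar S k) (hlT : IsKStar T l)
    (h : Cfg a b c d S.V T.V k l)
    (hm : (Wset a b c d S.V T.V).card = 2 * m + 1)
    (hn : (Wset a b c d T.V S.V).card = 2 * n + 1)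
    (hnew : ∀ p q, Nw a b c d p q → (Wd S p q ∧ Wd T q p) ∨ (Wd T p q ∧ Wd S q p))
    (hsub : ∀ p q, SE (Wset a b c d S.V T.V) m p q →
      (p, q) ∈ S.E ∨ (p, q) ∈ T.E ∨ Nw a b c d p q)
    (hdis : ∀ p q, SE (Wset a b c d S.V T.V) m p q → ¬ SE (Wset a b c d T.V S.V) n p q)
    {p q r x : ℂ} (h1 : SE (Wset a b c d S.V T.V) m p q) (h2 : SE (Wset a b c d S.V T.V) m q r)
    (hx : s(q, x) ∈ D ∨ Nw a b c d q x) (hrx : Cy q r x) (hxp : Cy q x p) : False := by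
  rcases hx with hx | hx
  · have nx : ‖x‖ = 1 := (D_wd hd hx).2.1
    have out : (q ∈ S.V ∧ (r = S.next q ∨ Cy q (S.next q) r)) ∨
        (q ∈ T.V ∧ (r = T.next q ∨ Cy q (T.next q) r)) := by
      rcases hsub _ _ h2 with e | e | e
      · have := (S.endmem _ e).1
        exact Or.inl ⟨this, Or.inl (next_unique S e (next_edge S this))⟩
      · have := (T.endmem _ e).1
        exact Or.inr ⟨this, Or.inl (next_unique T e (next_edge T this))⟩
      · rcases hnew _ _ e with ⟨f, _⟩ | ⟨f, _⟩
        · exact Or.inl ⟨f.1, Or.inr f.2.2.1⟩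
        · exact Or.inr ⟨f.1, Or.inr f.2.2.1⟩
    have inn : (q ∈ S.V ∧ (p = S.prev q ∨ Cy q p (S.prev q))) ∨
        (q ∈ T.V ∧ (p = T.prev q ∨ Cy q p (T.prev q))) := by
      rcases hsub _ _ h1 with e | e | e
      · have := (S.endmem _ e).2
        exact Or.inl ⟨this, Or.inl (prev_unique S e (prev_edge S this))⟩
      · have := (T.endmem _ e).2
        exact Or.inr ⟨this, Or.inl (prev_unique T e (prev_edge T this))⟩
      · rcases hnew _ _ e.symm with ⟨f, _⟩ | ⟨f, _⟩
        · exact Or.inl ⟨f.1, Or.inr f.2.2.2⟩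
        · exact Or.inr ⟨f.1, Or.inr f.2.2.2⟩
    have fin : ∀ R ∈ 𝒮, q ∈ R.V → (r = R.next q ∨ Cy q (R.next q) r) →
        (p = R.prev q ∨ Cy q p (R.prev q)) → False := by
      intro R hR hq e f
      refine not_wd_D hd hR hx ⟨hq, nx, ?_, ?_⟩
      · rcases e with e | e
        · rw [← e]; exact hrx
        · exact e.trans hrx
      · rcases f with e | e
        · rw [← e]; exact hxp
        · exact hxp.trans e
    have mixed : q ∈ S.V → q ∈ T.V →
        ((q, r) ∈ S.E ∧ (p, q) ∈ T.E) ∨ ((q, r) ∈ T.E ∧ (p, q) ∈ S.E) → False := by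
      intro qS qT hh
      have na : q ≠ a := by rintro rfl; exact h.aXY.1 qS qT
      have nb : q ≠ b := by rintro rfl; exact h.bXY.1 qS qT
      have nc : q ≠ c := by rintro rfl; exact h.cXY.1 qS qT
      have nd : q ≠ d := by rintro rfl; exact h.dXY.1 qS qT
      have key : (Cy a q b ∨ Cy c q d) ∧ (Cy b q c ∨ Cy d q a) := by
        rcases hh with ⟨e, f⟩ | ⟨e, f⟩
        · constructor
          · rcases h.old hm hn ((kstar_edge hkS).1 e) with ⟨_, A⟩ | ⟨A, _⟩
            · rcases A with ⟨A, _⟩ | ⟨A, _⟩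
              · exact Or.inl (A.strict na nb)
              · exact Or.inr (A.strict nc nd)
            · exact absurd A (hdis _ _ h2)
          · rcases h.swap.old hn hm ((kstar_edge hlT).1 f) with ⟨A, _⟩ | ⟨_, A⟩
            · exact absurd A (hdis _ _ h1)
            · rcases A with ⟨_, A⟩ | ⟨_, A⟩
              · exact Or.inr (A.strict nd na)
              · exact Or.inl (A.strict nb nc)
        · constructor
          · rcases h.old hm hn ((kstar_edge hkS).1 f) with ⟨_, A⟩ | ⟨A, _⟩
            · rcases A with ⟨_, A⟩ | ⟨_, A⟩
              · exact Or.inr (A.strict nc nd)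
              · exact Or.inl (A.strict na nb)
            · exact absurd A (hdis _ _ h1)
          · rcases h.swap.old hn hm ((kstar_edge hlT).1 e) with ⟨A, _⟩ | ⟨_, A⟩
            · exact absurd A (hdis _ _ h2)
            · rcases A with ⟨A, _⟩ | ⟨A, _⟩
              · exact Or.inl (A.strict nb nc)
              · exact Or.inr (A.strict nd na)
      exact mixed_aux h.abc h.cda h.bcd h.dab key.1 key.2
    have nomix : ∀ y, Nw a b c d q y → q ∈ S.V → q ∈ T.V → False := by
      intro y e qS qT
      rcases hnew _ _ e with ⟨f, g⟩ | ⟨f, g⟩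
      · exact g.not_mem hlT qT
      · exact g.not_mem hkS qS
    by_cases both : q ∈ S.V ∧ q ∈ T.V
    · obtain ⟨qS, qT⟩ := both
      rcases hsub _ _ h1 with e | e | e
      · rcases hsub _ _ h2 with f | f | f
        · exact fin S hS qS (Or.inl (next_unique S f (next_edge S qS)))
            (Or.inl (prev_unique S e (prev_edge S qS)))
        · exact mixed qS qT (Or.inr ⟨f, e⟩)
        · exact nomix _ f qS qT
      · rcases hsub _ _ h2 with f | f | f
        · exact mixed qS qT (Or.inl ⟨f, e⟩)
        · exact fin T hT qT (Or.inl (next_unique T f (next_edge T qT)))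
            (Or.inl (prev_unique T e (prev_edge T qT)))
        · exact nomix _ f qS qT
      · exact nomix _ e.symm qS qT
    · rcases out with ⟨o1, o2⟩ | ⟨o1, o2⟩ <;> rcases inn with ⟨i1, i2⟩ | ⟨i1, i2⟩
      · exact fin S hS o1 o2 i2
      · exact both ⟨o1, i1⟩
      · exact both ⟨i1, o1⟩
      · exact fin T hT o1 o2 i2
  · have hxW : x ∈ Wset a b c d S.V T.V := by
      obtain ⟨m1, m2, m3, m4⟩ := memW (a := a) (b := b) (c := c) (d := d) (X := S.V) (Y := T.V)
      rcases hx with ⟨_, e⟩ | ⟨_, e⟩ | ⟨_, e⟩ | ⟨_, e⟩ <;> rw [e] <;> assumption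
    have c1 := cnt_lt h.W1 h2.2.1 hrx
    have c2 := cnt_lt h.W1 hxW hxp
    have c3 := h1.rev h.W1 hm
    have c4 := h2.2.2.2
    omega

set_option maxHeartbeats 4000000 in
lemma contra (hmax : IsMaximalStarDecomp P D 𝒮) {S T : CyclicPolygon} (hS : S ∈ 𝒮) (hT : T ∈ 𝒮)
    (hne : S ≠ T) (hac : Wd S a c) (hca : Wd T c a) (hbd : Wd S b d) (hdb : Wd T d b)
    (h1 : Cy a b c) (h2 : Cy c d a) : False := by
  obtain ⟨hd, hmax⟩ := hmax
  obtain ⟨⟨k, hk, hkS⟩, hSP⟩ := hd.2.1 S hS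
  obtain ⟨⟨l, hl, hlT⟩, hTP⟩ := hd.2.1 T hT
  have cX := hac.not_mem hkS
  have dX := hbd.not_mem hkS
  have aY := hca.not_mem hlT
  have bY := hdb.not_mem hlT
  have aX := hac.1
  have bX := hbd.1
  have cY := hca.1
  have dY := hdb.1
  have h : Cfg a b c d S.V T.V k l :=
    { X1 := S.onCircle, Y1 := T.onCircle
      na := hca.2.1, nb := hdb.2.1, nc := hac.2.1, nd := hbd.2.1
      abc := h1, cda := h2, cX := hkS.1, cY := hlT.1
      acX := by tauto
      bdX := by tauto
      aXY := by tauto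
      bXY := by tauto
      cXY := by tauto
      dXY := by tauto
      Xac := (hac.cnt hkS).1, Xca := (hac.cnt hkS).2
      Xbd := (hbd.cnt hkS).1, Xdb := (hbd.cnt hkS).2
      Yac := (hca.cnt hlT).2, Yca := (hca.cnt hlT).1
      Ybd := (hdb.cnt hlT).2, Ydb := (hdb.cnt hlT).1 }
  obtain ⟨m, m0, hm, m2, _⟩ := h.counts
  obtain ⟨n, n0, hn, n2, _⟩ := h.swap.counts
  simp only [bX, cX, bY, cY, if_true, if_false] at m2 n2
  have nac : a ≠ c := h.ac
  have nbd : b ≠ d := h.rot.ac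
  have nab : a ≠ b := h1.ne.1
  have ncd : c ≠ d := h2.ne.1
  have nad : a ≠ d := h2.ne.2.1.symm
  have nbc : b ≠ c := h1.ne.2.1
  -- new edges
  have hnew : ∀ p q, Nw a b c d p q → (Wd S p q ∧ Wd T q p) ∨ (Wd T p q ∧ Wd S q p) := by
    rintro p q (⟨rfl, rfl⟩ | ⟨rfl, rfl⟩ | ⟨rfl, rfl⟩ | ⟨rfl, rfl⟩) <;> tauto
  have hnewSE : ∀ p q, Nw a b c d p q → SE (Wset a b c d S.V T.V) m p q ∨
      SE (Wset a b c d T.V S.V) n p q := by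
    have r1 : Wset c d a b T.V S.V = Wset a b c d T.V S.V := by rw [← Wset_rot a, ← Wset_rot b]
    have r2 : Wset b c d a S.V T.V = Wset a b c d T.V S.V := by rw [← Wset_rot a]
    have r3 : Wset d a b c T.V S.V = Wset a b c d S.V T.V := by
      rw [← Wset_rot a, ← Wset_rot b, ← Wset_rot c]
    rintro p q (⟨rfl, rfl⟩ | ⟨rfl, rfl⟩ | ⟨rfl, rfl⟩ | ⟨rfl, rfl⟩)
    · exact Or.inl (h.edge_new hm cX)
    · have := h.rot.rot.swap.edge_new (m := n) (by rw [r1]; exact hn) aY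
      rw [r1] at this; exact Or.inr this
    · have := h.rot.swap.edge_new (m := n) (by rw [r2]; exact hn) dX
      rw [r2] at this; exact Or.inr this
    · have := h.rot.rot.rot.edge_new (m := m) (by rw [r3]; exact hm) bY
      rw [r3] at this; exact Or.inl this
  set S1 := mkStar (Wset a b c d S.V T.V) m h.W1 hm m0 with hS1
  set S2 := mkStar (Wset a b c d T.V S.V) n h.swap.W1 hn n0 with hS2
  have mem1 : ∀ p q, (p, q) ∈ S1.E ↔ SE (Wset a b c d S.V T.V) m p q := fun p q => mem_mkStar
  have mem2 : ∀ p q, (p, q) ∈ S2.E ↔ SE (Wset a b c d T.V S.V) n p q := fun p q => mem_mkStar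
  let N : Finset (ℂ × ℂ) := {(a, c), (c, a), (b, d), (d, b)}
  have memN : ∀ p q, (p, q) ∈ N ↔ Nw a b c d p q := by
    intro p q
    simp [N, Nw]
  have cardN : N.card = 4 := by
    simp only [N]
    rw [Finset.card_insert_of_notMem, Finset.card_insert_of_notMem, Finset.card_insert_of_notMem,
      Finset.card_singleton]
    · simp [nbd]
    · simp [nbc.symm, ncd]
    · simp [nab, nad, nac]
  have dST : Disjoint S.E T.E := Finset.disjoint_left.2 fun e he =>
    hd.2.2.2.2.1 S hS T hT hne e he
  have dN : Disjoint (S.E ∪ T.E) N := by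
    rw [Finset.disjoint_left]
    rintro ⟨p, q⟩ he hN
    rw [memN] at hN
    rw [Finset.mem_union] at he
    rcases he with he | he
    · have := S.endmem _ he
      rcases hN with ⟨rfl, rfl⟩ | ⟨rfl, rfl⟩ | ⟨rfl, rfl⟩ | ⟨rfl, rfl⟩ <;> tauto
    · have := T.endmem _ he
      rcases hN with ⟨rfl, rfl⟩ | ⟨rfl, rfl⟩ | ⟨rfl, rfl⟩ | ⟨rfl, rfl⟩ <;> tauto
  have hU : (S.E ∪ T.E) ∪ N ⊆ S1.E ∪ S2.E := by
    rintro ⟨p, q⟩ he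
    rw [Finset.mem_union, mem1, mem2]
    rw [Finset.mem_union, Finset.mem_union, memN] at he
    rcases he with (he | he) | he
    · have := h.old hm hn ((kstar_edge hkS).1 he); tauto
    · have := h.swap.old hn hm ((kstar_edge hlT).1 he); tauto
    · exact hnewSE _ _ he
  have cU : ((S.E ∪ T.E) ∪ N).card = (2 * k + 1) + (2 * l + 1) + 4 := by
    rw [Finset.card_union_of_disjoint dN, Finset.card_union_of_disjoint dST, card_E, card_E,
      hkS.1, hlT.1, cardN]
  have c1 : S1.E.card = 2 * m + 1 := (card_E S1).trans hm
  have c2 : S2.E.card = 2 * n + 1 := (card_E S2).trans hn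
  have cle := Finset.card_le_card hU
  have cle2 := Finset.card_union_le S1.E S2.E
  have hEq : (S.E ∪ T.E) ∪ N = S1.E ∪ S2.E := Finset.eq_of_subset_of_card_le hU (by omega)
  have hDis : Disjoint S1.E S2.E := by
    rw [← Finset.card_union_eq_card_add_card]; omega
  have hmemU : ∀ p q, (p, q) ∈ S1.E ∨ (p, q) ∈ S2.E →
      (p, q) ∈ S.E ∨ (p, q) ∈ T.E ∨ Nw a b c d p q := by
    intro p q hh
    rw [← Finset.mem_union, ← hEq, Finset.mem_union, Finset.mem_union, memN] at hh
    tauto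
  have hdis1 : ∀ p q, SE (Wset a b c d S.V T.V) m p q → ¬ SE (Wset a b c d T.V S.V) n p q := by
    intro p q e f
    exact Finset.disjoint_left.1 hDis ((mem1 p q).2 e) ((mem2 p q).2 f)
  have subP : ∀ p q, Nw a b c d p q → Wd P p q := by
    intro p q e
    rcases hnew _ _ e with f | f
    · exact wd_sub hd hS f.1
    · exact wd_sub hd hT f.1
  have notD : ∀ p q, Nw a b c d p q → s(p, q) ∉ D := by
    intro p q e hD
    rcases hnew _ _ e with f | f
    · exact not_wd_D hd hS hD f.1
    · exact not_wd_D hd hT hD f.1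
  let D' : Set (Sym2 ℂ) := {e | e ∈ D ∨ e = s(a, c) ∨ e = s(b, d)}
  have memD' : ∀ p q, s(p, q) ∈ D' ↔ s(p, q) ∈ D ∨ Nw a b c d p q := by
    intro p q
    simp only [D', Set.mem_ofPred_eq, Sym2.eq_iff, Nw]
    tauto
  have hDD : D ⊂ D' := by
    refine ⟨fun e he => Or.inl he, fun hsub => ?_⟩
    exact notD a c (Or.inl ⟨rfl, rfl⟩) (hsub (Or.inr (Or.inl rfl)))
  have W1P : (S1.V : Set ℂ) ⊆ P.V ∧ (S2.V : Set ℂ) ⊆ P.V := by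
    have := hSP aX
    have := hSP bX
    have := hTP cY
    have := hTP dY
    constructor
    · intro x hx
      have hx' : x ∈ Wset a b c d S.V T.V := hx
      simp only [Wset, Finset.mem_union, Finset.mem_filter, Finset.mem_insert,
        Finset.mem_singleton] at hx'
      rcases hx' with ((rfl | rfl | rfl | rfl) | hx') | hx'
      any_goals assumption
      · exact hSP hx'.1
      · exact hTP hx'.1
    · intro x hx
      have hx' : x ∈ Wset a b c d T.V S.V := hx
      simp only [Wset, Finset.mem_union, Finset.mem_filter, Finset.mem_insert,
        Finset.mem_singleton] at hx'
      rcases hx' with ((rfl | rfl | rfl | rfl) | hx') | hx'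
      any_goals assumption
      · exact hTP hx'.1
      · exact hSP hx'.1
  have edgeP : ∀ p q, (p, q) ∈ S1.E ∨ (p, q) ∈ S2.E →
      (p, q) ∈ (P.E : Set (ℂ × ℂ)) ∪ tilde D' := by
    intro p q hh
    rcases hmemU p q hh with e | e | e
    · rcases hd.2.2.1 S hS e with f | f
      · exact Or.inl f
      · exact Or.inr (Or.inl f)
    · rcases hd.2.2.1 T hT e with f | f
      · exact Or.inl f
      · exact Or.inr (Or.inl f)
    · exact Or.inr ((memD' p q).2 (Or.inr e))
  have otherdis : ∀ R ∈ 𝒮, R ≠ S → R ≠ T → ∀ e : ℂ × ℂ, e ∈ R.E → e ∉ S1.E ∧ e ∉ S2.E := by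
    rintro R hR hRS hRT ⟨p, q⟩ he
    rw [← not_or]
    intro hh
    rcases hmemU p q hh with e | e | e
    · exact hd.2.2.2.2.1 R hR S hS hRS _ he e
    · exact hd.2.2.2.2.1 R hR T hT hRT _ he e
    · rcases hd.2.2.1 R hR he with f | f
      · have := subP p q e
        exact this.2.2.1.ne.2.1 (next_unique P (next_edge P this.1) f)
      · exact notD p q e f
  refine hmax D' hDD ⟨insert S1 (insert S2 ((𝒮.erase S).erase T)), ?_, ?_, ?_, ?_, ?_, ?_⟩
  · intro x y hxy
    rcases (memD' x y).1 hxy with e | e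
    · exact hd.1 x y e
    · exact (linkable_iff P P).2 ⟨subP _ _ e, subP _ _ e.symm⟩
  · intro R hR
    simp only [Finset.mem_insert, Finset.mem_erase] at hR
    rcases hR with rfl | rfl | hR
    · exact ⟨mkStar_isStar _ _ _, W1P.1⟩
    · exact ⟨mkStar_isStar _ _ _, W1P.2⟩
    · exact hd.2.1 R hR.2.2
  · intro R hR
    simp only [Finset.mem_insert, Finset.mem_erase] at hR
    rcases hR with rfl | rfl | hR
    · rintro ⟨p, q⟩ he; exact edgeP p q (Or.inl he)
    · rintro ⟨p, q⟩ he; exact edgeP p q (Or.inr he)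
    · intro e he
      rcases hd.2.2.1 R hR.2.2 he with f | f
      · exact Or.inl f
      · exact Or.inr (Or.inl f)
  · have fromU : ∀ e, e ∈ (S.E ∪ T.E) ∪ N →
        ∃ R ∈ insert S1 (insert S2 ((𝒮.erase S).erase T)), e ∈ R.E := by
      intro e he
      rcases Finset.mem_union.1 (hU he) with f | f
      · exact ⟨S1, by simp, f⟩
      · exact ⟨S2, by simp, f⟩
    have fromOld : ∀ e ∈ (P.E : Set (ℂ × ℂ)) ∪ tilde D,
        ∃ R ∈ insert S1 (insert S2 ((𝒮.erase S).erase T)), e ∈ R.E := by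
      intro e he
      obtain ⟨R, hR, heR⟩ := hd.2.2.2.1 e he
      by_cases e1 : R = S
      · subst e1; exact fromU e (by simp [heR])
      by_cases e2 : R = T
      · subst e2; exact fromU e (by simp [heR])
      · exact ⟨R, by simp [e1, e2, hR], heR⟩
    rintro ⟨p, q⟩ (he | he)
    · exact fromOld _ (Or.inl he)
    · rcases (memD' p q).1 he with f | f
      · exact fromOld _ (Or.inr f)
      · exact fromU _ (Finset.mem_union_right _ ((memN p q).2 f))
  · intro R hR R' hR' hRR e he he'
    simp only [Finset.mem_insert, Finset.mem_erase] at hR hR'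
    rcases hR with rfl | rfl | hR <;> rcases hR' with rfl | rfl | hR'
    · exact hRR rfl
    · exact Finset.disjoint_left.1 hDis he he'
    · exact (otherdis R' hR'.2.2 hR'.2.1 hR'.1 e he').1 he
    · exact Finset.disjoint_left.1 hDis he' he
    · exact hRR rfl
    · exact (otherdis R' hR'.2.2 hR'.2.1 hR'.1 e he').2 he
    · exact (otherdis R hR.2.2 hR.2.1 hR.1 e he).1 he'
    · exact (otherdis R hR.2.2 hR.2.1 hR.1 e he).2 he'
    · exact hd.2.2.2.2.1 R hR.2.2 R' hR'.2.2 hRR e he he'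
  · rintro R hR p q r hpq hqr ⟨x, hx, hsp⟩
    have hx' := (memD' q x).1 hx
    have wP : Wd P q x := by
      rcases hx' with e | e
      · exact D_wd hd e
      · exact subP _ _ e
    have hqx : x ≠ q := wP.2.2.2.ne.1.symm
    obtain ⟨s1, s2⟩ := (splits_iff (R.onCircle _ (R.endmem _ hpq).1) (R.onCircle _ (R.endmem _ hpq).2)
      (R.onCircle _ (R.endmem _ hqr).2) wP.2.1 (edge_cy R hpq hqr) hqx).1 hsp
    simp only [Finset.mem_insert, Finset.mem_erase] at hR
    rcases hR with rfl | rfl | hR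
    · exact nosplit hd hS hT hkS hlT h hm hn hnew
        (fun p q e => hmemU p q (Or.inl ((mem1 p q).2 e))) hdis1
        ((mem1 _ _).1 hpq) ((mem1 _ _).1 hqr) hx' s1 s2
    · refine nosplit hd hT hS hlT hkS h.swap hn hm (fun p q e => (hnew p q e).symm)
        (fun p q e => ?_) (fun p q e f => hdis1 p q f e)
        ((mem2 _ _).1 hpq) ((mem2 _ _).1 hqr) hx' s1 s2
      have := hmemU p q (Or.inr ((mem2 p q).2 e))
      tauto
    · have hqR := (R.endmem _ hpq).2
      have wR : Wd R q x := by
        refine ⟨hqR, wP.2.1, ?_, ?_⟩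
        · rw [next_unique R (next_edge R hqR) hqr]; exact s1
        · rw [prev_unique R (prev_edge R hqR) hpq]; exact s2
      rcases hx' with e | e
      · exact not_wd_D hd hR.2.2 e wR
      · rcases hnew _ _ e with f | f
        · exact nonoverlap hd hR.2.2 hS hR.2.1 wR f.1
        · exact nonoverlap hd hR.2.2 hT hR.1 wR f.1

lemma unique_wd (hmax : IsMaximalStarDecomp P D 𝒮) {S T : CyclicPolygon} (hS : S ∈ 𝒮) (hT : T ∈ 𝒮)
    (hne : S ≠ T) {u v u' v' : ℂ} (h1 : Wd S u v) (h2 : Wd T v u) (h3 : Wd S u' v')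
    (h4 : Wd T v' u') : u = u' ∧ v = v' := by
  obtain ⟨⟨k, hk, hkS⟩, hSP⟩ := hmax.1.2.1 S hS
  obtain ⟨⟨l, hl, hlT⟩, hTP⟩ := hmax.1.2.1 T hT
  have nu := h2.2.1
  have nv := h1.2.1
  have nu' := h4.2.1
  have nv' := h3.2.1
  have d1 : u ≠ v := h1.2.2.2.ne.1
  have d2 : u' ≠ v' := h3.2.2.2.ne.1
  have d3 : u ≠ v' := fun e => h3.not_mem hkS (e ▸ h1.1)
  have d4 : u' ≠ v := fun e => h1.not_mem hkS (e ▸ h3.1)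
  have hu : u = u' → v = v' := by
    rintro rfl
    by_contra hv
    have a1 := (h2.cnt hlT).2
    have a2 := (h4.cnt hlT).2
    rcases Cy.total nu nv nv' d1 hv d3 with c | c
    · have := cnt_lt T.onCircle h2.1 c; omega
    · have := cnt_lt T.onCircle h4.1 c; omega
  have hv : v = v' → u = u' := by
    rintro rfl
    by_contra hv
    have a1 := (h1.cnt hkS).2
    have a2 := (h3.cnt hkS).2
    rcases Cy.total nv nu nu' d1.symm hv d2.symm with c | c
    · have := cnt_lt S.onCircle h1.1 c; omega
    · have := cnt_lt S.onCircle h3.1 c; omega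
  by_contra hcon
  have d5 : u ≠ u' := fun e => hcon ⟨e, hu e⟩
  have d6 : v ≠ v' := fun e => hcon ⟨hv e, e⟩
  have b1 := h1.bis hkS
  have b2 := h3.bis hkS
  rcases Cy.total nu nu' nv d5 d4 d1 with c | c
  · rcases Cy.total nu nv' nv d3 d6.symm d1 with e | e
    · rcases Cy.total nu nu' nv' d5 d2 d3 with f | f
      · refine b2.cross S.onCircle hkS.1 b1.symm ?_ ?_ <;> unfold Cy at * <;> grind
      · refine b2.symm.cross S.onCircle hkS.1 b1.symm ?_ ?_ <;> unfold Cy at * <;> grind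
    · exact contra hmax hS hT hne h1 h2 h3 h4 c e.rot
  · rcases Cy.total nu nv' nv d3 d6.symm d1 with e | e
    · exact contra hmax hS hT hne h3 h4 h1 h2 (by unfold Cy at *; grind) (by unfold Cy at *; grind)
    · rcases Cy.total nu nu' nv' d5 d2 d3 with f | f
      · refine b1.cross S.onCircle hkS.1 b2 ?_ ?_ <;> unfold Cy at * <;> grind
      · refine b1.cross S.onCircle hkS.1 b2.symm ?_ ?_ <;> unfold Cy at * <;> grind

end splice

end ULP

/-- In a maximal star decomposition, every pair of distinct stars has exactly
one linkable pair. -/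
theorem unique_linkable_pair (P : CyclicPolygon) (D : Set (Sym2 ℂ)) (𝒮 : Finset CyclicPolygon)
    (h : IsMaximalStarDecomp P D 𝒮) :
    ∀ S₁ ∈ 𝒮, ∀ S₂ ∈ 𝒮, S₁ ≠ S₂ →
      ∃! q : ℂ × ℂ, q.1 ∈ S₁.V ∧ q.2 ∈ S₂.V ∧ LinkablePair S₁ S₂ q.1 q.2 := by
  intro S hS T hT hne
  obtain ⟨u, v, h1, h2⟩ := ULP.exists_linkable h.1 hS hT hne
  refine ⟨(u, v), ⟨h1.1, h2.1, (ULP.linkable_iff S T).2 ⟨h1, h2⟩⟩, ?_⟩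
  rintro ⟨u', v'⟩ ⟨_, _, h3⟩
  obtain ⟨h3, h4⟩ := (ULP.linkable_iff S T).1 h3
  obtain ⟨e1, e2⟩ := ULP.unique_wd h hS hT hne h3 h4 h1 h2
  exact Prod.ext e1 e2

end
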